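/- arXiv:math/0309328 — 4 statements merged into one kernel-verified Lean document; each statement's English description precedes it below -/
import Mathlib

section
/- Let a < b and c < d be real numbers, and let β, v : (a,b) → ℝ³ be C¹ maps with locally Lipschitz derivatives. Define F : (a,b) × (c,d) → ℝ³ by F(s,t) = β(s) + t·v(s), and set Σ = F((a,b) × (c,d)). Assume that for every (s,t) ∈ (a,b) × (c,d) the cross product (β'(s) + t·v'(s)) × v(s) is nonzero, and that F is a homeomorphism from (a,b) × (c,d) onto Σ (with the subspace topology from ℝ³). If there exist ε₁, ε₂ with c ≤ ε₁ < ε₂ ≤ d such that F((a,b) × (ε₁,ε₂)) is a C^∞ embedded 2-dimensional submanifold of ℝ³, then the whole ruled surface Σ is a C^∞ embedded 2-dimensional submanifold of ℝ³. -/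
open Set

/-- `S ⊆ ℝ³` is a `C^∞` embedded 2-dimensional submanifold of `ℝ³`: every point of
`S` has an open neighborhood `U` in `ℝ³` and a `C^∞` diffeomorphism `φ` from `U`
onto an open subset of `ℝ³` with `φ(U ∩ S) = φ(U) ∩ (ℝ² × {0})`. -/
def IsSmoothSurface (S : Set (Fin 3 → ℝ)) : Prop :=
  ∀ p ∈ S, ∃ U : Set (Fin 3 → ℝ), ∃ φ ψ : (Fin 3 → ℝ) → (Fin 3 → ℝ),
    IsOpen U ∧ p ∈ U ∧ IsOpen (φ '' U) ∧
    ContDiffOn ℝ (⊤ : ℕ∞) φ U ∧ ContDiffOn ℝ (⊤ : ℕ∞) ψ (φ '' U) ∧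
    (∀ x ∈ U, ψ (φ x) = x) ∧ (∀ y ∈ φ '' U, φ (ψ y) = y) ∧
    φ '' (U ∩ S) = (φ '' U) ∩ {x | ∀ i : Fin 3, 2 ≤ (i : ℕ) → x i = 0}

namespace RuledSurface

open Filter Topology MeasureTheory Polynomial
open scoped ContDiff

/-- `f` is Lipschitz on some neighborhood of `x`. -/
def LipAt {E F : Type*} [PseudoEMetricSpace E] [PseudoEMetricSpace F] (f : E → F) (x : E) : Prop :=
  ∃ C : NNReal, ∃ t ∈ 𝓝 x, LipschitzOnWith C f t

section LipAt

variable {E F G : Type*} [PseudoEMetricSpace E]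

theorem LipAt.continuousAt [PseudoEMetricSpace F] {f : E → F} {x : E} (hf : LipAt f x) :
    ContinuousAt f x := by
  obtain ⟨C, t, ht, h⟩ := hf
  exact h.continuousOn.continuousAt ht

theorem LipAt.comp [PseudoEMetricSpace F] [PseudoEMetricSpace G] {g : F → G} {f : E → F} {x : E}
    (hg : LipAt g (f x)) (hf : LipAt f x) : LipAt (fun y => g (f y)) x := by
  have hc := hf.continuousAt
  obtain ⟨C, t, ht, h⟩ := hf
  obtain ⟨C', t', ht', h'⟩ := hg
  exact ⟨C' * C, t ∩ f ⁻¹' t', inter_mem ht (hc ht'),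
    h'.comp (h.mono inter_subset_left) fun y hy => hy.2⟩

theorem LipAt.prodMk [PseudoEMetricSpace F] [PseudoEMetricSpace G] {f : E → F} {g : E → G} {x : E}
    (hf : LipAt f x) (hg : LipAt g x) : LipAt (fun y => (f y, g y)) x := by
  obtain ⟨C, t, ht, h⟩ := hf
  obtain ⟨C', t', ht', h'⟩ := hg
  exact ⟨max C C', t ∩ t', inter_mem ht ht',
    (h.mono inter_subset_left).prodMk (h'.mono inter_subset_right)⟩

theorem _root_.ContDiffAt.lipAt {E F : Type*} [NormedAddCommGroup E] [NormedSpace ℝ E]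
    [NormedAddCommGroup F] [NormedSpace ℝ F] {f : E → F} {x : E} (hf : ContDiffAt ℝ 1 f x) :
    LipAt f x :=
  hf.exists_lipschitzOnWith

theorem LipAt.const [PseudoEMetricSpace F] (c : F) (x : E) : LipAt (fun _ => c) x :=
  ⟨0, univ, univ_mem, (LipschitzWith.const c).lipschitzOnWith⟩

variable {f g : E → ℝ} {x : E}

theorem LipAt.add (hf : LipAt f x) (hg : LipAt g x) : LipAt (fun y => f y + g y) x :=
  LipAt.comp (f := fun y => (f y, g y))
    (show ContDiffAt ℝ 1 (fun p : ℝ × ℝ => p.1 + p.2) (f x, g x) by fun_prop).lipAt (hf.prodMk hg)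

theorem LipAt.sub (hf : LipAt f x) (hg : LipAt g x) : LipAt (fun y => f y - g y) x :=
  LipAt.comp (f := fun y => (f y, g y))
    (show ContDiffAt ℝ 1 (fun p : ℝ × ℝ => p.1 - p.2) (f x, g x) by fun_prop).lipAt (hf.prodMk hg)

theorem LipAt.mul (hf : LipAt f x) (hg : LipAt g x) : LipAt (fun y => f y * g y) x :=
  LipAt.comp (f := fun y => (f y, g y))
    (show ContDiffAt ℝ 1 (fun p : ℝ × ℝ => p.1 * p.2) (f x, g x) by fun_prop).lipAt (hf.prodMk hg)

theorem LipAt.pow (hf : LipAt f x) (n : ℕ) : LipAt (fun y => f y ^ n) x :=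
  (show ContDiffAt ℝ 1 (fun p : ℝ => p ^ n) (f x) by fun_prop).lipAt.comp hf

theorem LipAt.div (hf : LipAt f x) (hg : LipAt g x) (h : g x ≠ 0) :
    LipAt (fun y => f y / g y) x :=
  LipAt.comp (f := fun y => (f y, g y))
    (show ContDiffAt ℝ 1 (fun p : ℝ × ℝ => p.1 / p.2) (f x, g x) from
      contDiffAt_fst.div contDiffAt_snd h).lipAt (hf.prodMk hg)

theorem LipAt.sum {ι : Type*} {f : ι → E → ℝ} (S : Finset ι) (h : ∀ i ∈ S, LipAt (f i) x) :
    LipAt (fun y => ∑ i ∈ S, f i y) x := by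
  classical
  induction S using Finset.induction_on with
  | empty => simpa using LipAt.const (0 : ℝ) x
  | insert i S hi ih =>
    simp only [Finset.sum_insert hi]
    exact (h i (by simp)).add (ih fun j hj => h j (by simp [hj]))

end LipAt

theorem LipAt.exists_Icc {f : ℝ → ℝ} {s : ℝ} {I : Set ℝ} (hI : I ∈ 𝓝 s) (hf : LipAt f s) :
    ∃ r > 0, ∃ C : NNReal, Icc (s - r) (s + r) ⊆ I ∧ LipschitzOnWith C f (Icc (s - r) (s + r)) := by
  obtain ⟨C, t, ht, h⟩ := hf
  obtain ⟨r, hr, hsub⟩ := Metric.nhds_basis_closedBall.mem_iff.1 (inter_mem hI ht)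
  rw [Real.closedBall_eq_Icc] at hsub
  exact ⟨r, hr, C, hsub.trans inter_subset_left, h.mono (hsub.trans inter_subset_right)⟩

/-- A locally Lipschitz function is differentiable almost everywhere. -/
theorem ae_differentiableAt_of_lipAt {f : ℝ → ℝ} {I : Set ℝ}
    (hf : ∀ s ∈ I, LipAt f s) : ∀ᵐ s, s ∈ I → DifferentiableAt ℝ f s := by
  rw [ae_iff]
  refine measure_null_of_locally_null _ fun x hx => ?_
  obtain ⟨hxI, -⟩ : x ∈ I ∧ ¬DifferentiableAt ℝ f x := by simpa using hx
  obtain ⟨C, t, ht, h⟩ := hf x hxI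
  obtain ⟨u, hut, hu, hxu⟩ := mem_nhds_iff.1 ht
  refine ⟨u ∩ {s | ¬(s ∈ I → DifferentiableAt ℝ f s)},
    inter_mem (mem_nhdsWithin_of_mem_nhds (hu.mem_nhds hxu)) self_mem_nhdsWithin, ?_⟩
  refine measure_mono_null ?_ (ae_iff.1 (h.mono hut).ae_differentiableWithinAt_of_mem_real)
  rintro s ⟨hsu, hs⟩ h'
  exact hs fun _ => (h' hsu).differentiableAt (hu.mem_nhds hsu)

/-- A locally Lipschitz function whose derivative agrees almost everywhere with a continuous
function is differentiable everywhere. -/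
theorem hasDerivAt_of_ae_of_lipAt {f φ : ℝ → ℝ} {I : Set ℝ} (hI : IsOpen I)
    (hf : ∀ s ∈ I, LipAt f s) (hφ : ContinuousOn φ I)
    (h : ∀ᵐ s, s ∈ I → HasDerivAt f (φ s) s) {s : ℝ} (hs : s ∈ I) : HasDerivAt f (φ s) s := by
  obtain ⟨r, hr, C, hsub, hC⟩ := (hf s hs).exists_Icc (hI.mem_nhds hs)
  have key : ∀ y ∈ Ioo (s - r) (s + r), f y = f (s - r) + ∫ x in (s - r)..y, φ x := by
    intro y hy
    have hsub' : uIcc (s - r) y ⊆ Icc (s - r) (s + r) := by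
      rw [uIcc_of_le hy.1.le]; exact Icc_subset_Icc_right hy.2.le
    have := (hC.mono hsub').absolutelyContinuousOnInterval.integral_deriv_eq_sub
    rw [intervalIntegral.integral_congr_ae (g := φ)] at this
    · linarith
    · filter_upwards [h] with x hx hx'
      exact (hx (hsub (hsub' (uIoc_subset_uIcc hx')))).deriv
  have h1 : HasDerivAt (fun y => f (s - r) + ∫ x in (s - r)..y, φ x) (φ s) s := by
    apply HasDerivAt.const_add
    apply intervalIntegral.integral_hasDerivAt_right
    · apply ContinuousOn.intervalIntegrable
      rw [uIcc_of_le (by linarith)]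
      exact hφ.mono ((Icc_subset_Icc_right (by linarith)).trans hsub)
    · exact hφ.stronglyMeasurableAtFilter hI s hs
    · exact hφ.continuousAt (hI.mem_nhds hs)
  refine h1.congr_of_eventuallyEq ?_
  filter_upwards [Ioo_mem_nhds (show s - r < s by linarith) (show s < s + r by linarith)] with y hy
  exact key y hy

theorem LipAt.congr {E F : Type*} [PseudoEMetricSpace E] [PseudoEMetricSpace F] {f g : E → F}
    {x : E} (hf : LipAt f x) (h : g =ᶠ[𝓝 x] f) : LipAt g x := by
  obtain ⟨C, t, ht, hC⟩ := hf
  refine ⟨C, t ∩ {y | g y = f y}, inter_mem ht h, fun y hy z hz => ?_⟩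
  rw [show g y = f y from hy.2, show g z = f z from hz.2]
  exact hC hy.1 hz.1

theorem lipAt_of_hasDerivAt {f f' : ℝ → ℝ} {x : ℝ} (h : ∀ᶠ y in 𝓝 x, HasDerivAt f (f' y) y)
    (hc : ContinuousAt f' x) : LipAt f x :=
  (hasStrictDerivAt_of_hasDerivAt_of_continuousAt h hc).hasStrictFDerivAt.exists_lipschitzOnWith

theorem hasDerivAt_of_pow_mul_eq {u J Q : ℝ → ℝ} {x j q : ℝ} {M : ℕ}
    (h : ∀ᶠ y in 𝓝 x, J y ^ M * u y = Q y) (hJ : HasDerivAt J j x) (hQ : HasDerivAt Q q x)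
    (hx : J x ≠ 0) : HasDerivAt u ((J x * q - M * j * Q x) / J x ^ (M + 1)) x := by
  have h1 : u =ᶠ[𝓝 x] fun y => Q y / J y ^ M := by
    filter_upwards [h, hJ.continuousAt.eventually_ne hx] with y hy hy'
    rw [← hy]; field_simp
  convert! (hQ.div (hJ.pow M) (pow_ne_zero M hx)).congr_of_eventuallyEq h1 using 1
  rcases M with _ | M
  · simp; field_simp
  · simp only [Nat.add_sub_cancel, Pi.pow_apply]; field_simp; ring

theorem linear_mul_mem_degreeLT {p : ℝ[X]} {n : ℕ} (hp : p ∈ degreeLT ℝ n) (a b : ℝ) :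
    (C a + C b * X) * p ∈ degreeLT ℝ (n + 1) := by
  rw [mem_degreeLT] at *
  rcases eq_or_ne p 0 with rfl | h0
  · simp
  · have h1 : (C a + C b * X : ℝ[X]).degree ≤ 1 := by
      rw [add_comm]; exact degree_linear_le
    rw [degree_mul]
    rw [degree_eq_natDegree h0] at *
    refine (add_le_add_left h1 _).trans_lt ?_
    norm_cast at hp ⊢
    omega

theorem C_mul_mem_degreeLT {p : ℝ[X]} {n : ℕ} (hp : p ∈ degreeLT ℝ n) (a : ℝ) :
    C a * p ∈ degreeLT ℝ n := by
  rw [← smul_eq_C_mul]; exact Submodule.smul_mem _ a hp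

theorem eval_interpolate_id (S : Finset ℝ) (c : ℝ → ℝ) (t : ℝ) :
    (Lagrange.interpolate S id c).eval t = ∑ τ ∈ S, c τ * (Lagrange.basis S id τ).eval t := by
  simp [Lagrange.interpolate_apply, eval_finsetSum]

theorem eval_derivative_interpolate_id (S : Finset ℝ) (c : ℝ → ℝ) (t : ℝ) :
    (Lagrange.interpolate S id c).derivative.eval t =
      ∑ τ ∈ S, c τ * (Lagrange.basis S id τ).derivative.eval t := by
  simp [Lagrange.interpolate_apply, eval_finsetSum]

theorem eq_interpolate_id {S : Finset ℝ} {P : ℝ[X]} {c : ℝ → ℝ} (hP : P ∈ degreeLT ℝ S.card)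
    (h : ∀ τ ∈ S, P.eval τ = c τ) : P = Lagrange.interpolate S id c :=
  Lagrange.eq_interpolate_of_eval_eq _ (Function.injective_id.injOn) (mem_degreeLT.1 hP) h

theorem interpolate_id_mem_degreeLT (S : Finset ℝ) (c : ℝ → ℝ) :
    Lagrange.interpolate S id c ∈ degreeLT ℝ S.card :=
  mem_degreeLT.2 (Lagrange.degree_interpolate_lt _ (Function.injective_id.injOn))

/-- A one-parameter family of parametrized lines `t ↦ (x₀ s + t x₁ s, y₀ s + t y₁ s)` in the plane,
of class `C^{1,1}` in the parameter `s`. -/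
structure PlanarRuling where
  I : Set ℝ
  (x₀ x₁ y₀ y₁ x₀' x₁' y₀' y₁' : ℝ → ℝ)
  isOpen_I : IsOpen I
  hasDerivAt_x₀ : ∀ s ∈ I, HasDerivAt x₀ (x₀' s) s
  hasDerivAt_x₁ : ∀ s ∈ I, HasDerivAt x₁ (x₁' s) s
  hasDerivAt_y₀ : ∀ s ∈ I, HasDerivAt y₀ (y₀' s) s
  hasDerivAt_y₁ : ∀ s ∈ I, HasDerivAt y₁ (y₁' s) s
  lipAt_x₀' : ∀ s ∈ I, LipAt x₀' s
  lipAt_x₁' : ∀ s ∈ I, LipAt x₁' s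
  lipAt_y₀' : ∀ s ∈ I, LipAt y₀' s
  lipAt_y₁' : ∀ s ∈ I, LipAt y₁' s

namespace PlanarRuling

variable (R : PlanarRuling)

def map (p : ℝ × ℝ) : ℝ × ℝ := (R.x₀ p.1 + p.2 * R.x₁ p.1, R.y₀ p.1 + p.2 * R.y₁ p.1)

def dx (s t : ℝ) : ℝ := R.x₀' s + t * R.x₁' s

def dy (s t : ℝ) : ℝ := R.y₀' s + t * R.y₁' s

/-- The Jacobian determinant of `R.map`. -/
def jac (s t : ℝ) : ℝ := R.dx s t * R.y₁ s - R.dy s t * R.x₁ s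

/-- `K` and `T` are open sets of parameters along the lines, `K ⊆ T`, and `R.map` is an
immersion on `R.I ×ˢ T`. -/
structure Domain (K T : Set ℝ) : Prop where
  subset : K ⊆ T
  isOpen_left : IsOpen K
  nonempty : K.Nonempty
  isOpen_right : IsOpen T
  jac_ne_zero : ∀ s ∈ R.I, ∀ t ∈ T, R.jac s t ≠ 0

/-- Functions of `(s, t)` which are rational in `t` with denominator a power of the Jacobian, and
are smooth functions of `R.map (s, t)` when `t ∈ K`. -/
structure Admissible (K T : Set ℝ) (u : ℝ → ℝ → ℝ) : Prop where
  rational : ∃ M N : ℕ, ∀ s ∈ R.I, ∃ P ∈ degreeLT ℝ N, ∀ t ∈ T, R.jac s t ^ M * u s t = P.eval t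
  smooth : ∃ g : ℝ × ℝ → ℝ, ∀ s ∈ R.I, ∀ t ∈ K,
    ContDiffAt ℝ ∞ g (R.map (s, t)) ∧ u s t = g (R.map (s, t))

variable {R} {K T : Set ℝ} {u : ℝ → ℝ → ℝ} {s : ℝ}

theorem eventually_mem_I (hs : s ∈ R.I) : ∀ᶠ y in 𝓝 s, y ∈ R.I := R.isOpen_I.mem_nhds hs

theorem lipAt_x₀ (hs : s ∈ R.I) : LipAt R.x₀ s :=
  lipAt_of_hasDerivAt ((eventually_mem_I hs).mono R.hasDerivAt_x₀) (R.lipAt_x₀' s hs).continuousAt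

theorem lipAt_x₁ (hs : s ∈ R.I) : LipAt R.x₁ s :=
  lipAt_of_hasDerivAt ((eventually_mem_I hs).mono R.hasDerivAt_x₁) (R.lipAt_x₁' s hs).continuousAt

theorem lipAt_y₀ (hs : s ∈ R.I) : LipAt R.y₀ s :=
  lipAt_of_hasDerivAt ((eventually_mem_I hs).mono R.hasDerivAt_y₀) (R.lipAt_y₀' s hs).continuousAt

theorem lipAt_y₁ (hs : s ∈ R.I) : LipAt R.y₁ s :=
  lipAt_of_hasDerivAt ((eventually_mem_I hs).mono R.hasDerivAt_y₁) (R.lipAt_y₁' s hs).continuousAt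

theorem lipAt_jac (hs : s ∈ R.I) (t : ℝ) : LipAt (fun y => R.jac y t) s :=
  (((R.lipAt_x₀' s hs).add ((LipAt.const t s).mul (R.lipAt_x₁' s hs))).mul (lipAt_y₁ hs)).sub
    (((R.lipAt_y₀' s hs).add ((LipAt.const t s).mul (R.lipAt_y₁' s hs))).mul (lipAt_x₁ hs))

theorem lipAt_map (hs : s ∈ R.I) (t : ℝ) : LipAt (fun y => R.map (y, t)) s :=
  ((lipAt_x₀ hs).add ((LipAt.const t s).mul (lipAt_x₁ hs))).prodMk
    ((lipAt_y₀ hs).add ((LipAt.const t s).mul (lipAt_y₁ hs)))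

theorem continuousAt_dx (hs : s ∈ R.I) (t : ℝ) :
    ContinuousAt (fun p : ℝ × ℝ => R.dx p.1 p.2) (s, t) := by
  have h1 : ContinuousAt (fun p : ℝ × ℝ => R.x₀' p.1) (s, t) :=
    (R.lipAt_x₀' s hs).continuousAt.comp_of_eq continuousAt_fst rfl
  have h2 : ContinuousAt (fun p : ℝ × ℝ => R.x₁' p.1) (s, t) :=
    (R.lipAt_x₁' s hs).continuousAt.comp_of_eq continuousAt_fst rfl
  exact h1.add (continuousAt_snd.mul h2)

theorem continuousAt_dy (hs : s ∈ R.I) (t : ℝ) :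
    ContinuousAt (fun p : ℝ × ℝ => R.dy p.1 p.2) (s, t) := by
  have h1 : ContinuousAt (fun p : ℝ × ℝ => R.y₀' p.1) (s, t) :=
    (R.lipAt_y₀' s hs).continuousAt.comp_of_eq continuousAt_fst rfl
  have h2 : ContinuousAt (fun p : ℝ × ℝ => R.y₁' p.1) (s, t) :=
    (R.lipAt_y₁' s hs).continuousAt.comp_of_eq continuousAt_fst rfl
  exact h1.add (continuousAt_snd.mul h2)

theorem continuousAt_jac (hs : s ∈ R.I) (t : ℝ) :
    ContinuousAt (fun p : ℝ × ℝ => R.jac p.1 p.2) (s, t) := by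
  have h1 : ContinuousAt (fun p : ℝ × ℝ => R.x₁ p.1) (s, t) :=
    (lipAt_x₁ hs).continuousAt.comp_of_eq continuousAt_fst rfl
  have h2 : ContinuousAt (fun p : ℝ × ℝ => R.y₁ p.1) (s, t) :=
    (lipAt_y₁ hs).continuousAt.comp_of_eq continuousAt_fst rfl
  exact ((continuousAt_dx hs t).mul h2).sub ((continuousAt_dy hs t).mul h1)

/-- Recover a function which is rational in `t` from finitely many values of `t`. -/
noncomputable def extend (R : PlanarRuling) (M : ℕ) (S : Finset ℝ) (h : ℝ → ℝ → ℝ)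
    (s t : ℝ) : ℝ :=
  (Lagrange.interpolate S id fun τ => R.jac s τ ^ M * h s τ).eval t / R.jac s t ^ M

theorem pow_mul_extend {M : ℕ} {S : Finset ℝ} {h : ℝ → ℝ → ℝ} {t : ℝ} (hJ : R.jac s t ≠ 0) :
    R.jac s t ^ M * R.extend M S h s t =
      (Lagrange.interpolate S id fun τ => R.jac s τ ^ M * h s τ).eval t :=
  mul_div_cancel₀ _ (pow_ne_zero M hJ)

theorem continuousAt_extend {M : ℕ} {S : Finset ℝ} {h : ℝ → ℝ → ℝ} {t : ℝ} (hs : s ∈ R.I)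
    (hJ : R.jac s t ≠ 0) (hh : ∀ τ ∈ S, ContinuousAt (fun y => h y τ) s) :
    ContinuousAt (fun p : ℝ × ℝ => R.extend M S h p.1 p.2) (s, t) := by
  unfold extend
  simp only [eval_interpolate_id]
  refine ContinuousAt.div ?_ ((continuousAt_jac hs t).pow M) (pow_ne_zero _ hJ)
  refine tendsto_finsetSum _ fun τ hτ => ?_
  refine ContinuousAt.mul (ContinuousAt.mul (ContinuousAt.pow ?_ M) ?_) (by fun_prop)
  · exact (lipAt_jac hs τ).continuousAt.comp_of_eq (f := Prod.fst) continuousAt_fst rfl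
  · exact (hh τ hτ).comp_of_eq (f := Prod.fst) continuousAt_fst rfl

theorem lipAt_extend {M : ℕ} {S : Finset ℝ} {h : ℝ → ℝ → ℝ} {t : ℝ} (hs : s ∈ R.I)
    (hJ : R.jac s t ≠ 0) (hh : ∀ τ ∈ S, LipAt (fun y => h y τ) s) :
    LipAt (fun y => R.extend M S h y t) s := by
  unfold extend
  simp only [eval_interpolate_id]
  refine LipAt.div ?_ ((lipAt_jac hs t).pow M) (pow_ne_zero _ hJ)
  exact LipAt.sum _ fun τ hτ => (((lipAt_jac hs τ).pow M).mul (hh τ hτ)).mul (LipAt.const _ _)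

theorem Domain.exists_nodes (hD : R.Domain K T) (n : ℕ) :
    ∃ S : Finset ℝ, (S : Set ℝ) ⊆ K ∧ S.card = n := by
  obtain ⟨t, ht⟩ := hD.nonempty
  exact (infinite_of_mem_nhds t (hD.isOpen_left.mem_nhds ht)).exists_subset_card_eq n

theorem Domain.eq_extend (hD : R.Domain K T) {M : ℕ} {S : Finset ℝ} (hS : (S : Set ℝ) ⊆ K)
    {P : ℝ[X]} (hP : P ∈ degreeLT ℝ S.card) (hs : s ∈ R.I)
    (h : ∀ t ∈ T, R.jac s t ^ M * u s t = P.eval t) {t : ℝ} (ht : t ∈ T) :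
    u s t = R.extend M S u s t := by
  have hJ := hD.jac_ne_zero s hs t ht
  rw [extend, ← eq_interpolate_id hP fun τ hτ => (h τ (hD.subset (hS hτ))).symm, ← h t ht]
  field_simp

theorem Admissible.lipAt_left (hu : R.Admissible K T u) (hs : s ∈ R.I) {t : ℝ} (ht : t ∈ K) :
    LipAt (fun y => u y t) s := by
  obtain ⟨g, hg⟩ := hu.smooth
  have h1 : LipAt (fun y => g (R.map (y, t))) s :=
    LipAt.comp (f := fun y => R.map (y, t))
      ((hg s hs t ht).1.of_le (by exact_mod_cast le_top)).lipAt (lipAt_map hs t)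
  exact h1.congr ((eventually_mem_I hs).mono fun y hy => (hg y hy t ht).2)

theorem Admissible.exists_eq_extend (hD : R.Domain K T) (hu : R.Admissible K T u) :
    ∃ (M : ℕ) (S : Finset ℝ), (S : Set ℝ) ⊆ K ∧
      ∀ s ∈ R.I, ∀ t ∈ T, u s t = R.extend M S u s t := by
  obtain ⟨M, N, h⟩ := hu.rational
  obtain ⟨S, hS, rfl⟩ := hD.exists_nodes N
  refine ⟨M, S, hS, fun s hs t ht => ?_⟩
  obtain ⟨P, hP, h⟩ := h s hs
  exact hD.eq_extend hS hP hs h ht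

theorem Admissible.continuousAt (hD : R.Domain K T) (hu : R.Admissible K T u) (hs : s ∈ R.I)
    {t : ℝ} (ht : t ∈ T) : ContinuousAt (fun p : ℝ × ℝ => u p.1 p.2) (s, t) := by
  obtain ⟨M, S, hS, h⟩ := hu.exists_eq_extend hD
  refine (continuousAt_extend (M := M) (S := S) (h := u) hs (hD.jac_ne_zero s hs t ht) fun τ hτ =>
    (hu.lipAt_left hs (hS hτ)).continuousAt).congr ?_
  filter_upwards [(R.isOpen_I.prod hD.isOpen_right).mem_nhds ⟨hs, ht⟩] with p hp
  exact (h _ hp.1 _ hp.2).symm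

theorem Admissible.lipAt (hD : R.Domain K T) (hu : R.Admissible K T u) (hs : s ∈ R.I)
    {t : ℝ} (ht : t ∈ T) : LipAt (fun y => u y t) s := by
  obtain ⟨M, S, hS, h⟩ := hu.exists_eq_extend hD
  exact (lipAt_extend hs (hD.jac_ne_zero s hs t ht) fun τ hτ =>
    hu.lipAt_left hs (hS hτ)).congr ((eventually_mem_I hs).mono fun y hy => h y hy t ht)

theorem hasDerivAt_map_left (hs : s ∈ R.I) (t : ℝ) :
    HasDerivAt (fun y => R.map (y, t)) (R.dx s t, R.dy s t) s :=
  ((R.hasDerivAt_x₀ s hs).add ((R.hasDerivAt_x₁ s hs).const_mul t)).prodMk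
    ((R.hasDerivAt_y₀ s hs).add ((R.hasDerivAt_y₁ s hs).const_mul t))

theorem hasDerivAt_map_right (s t : ℝ) :
    HasDerivAt (fun y => R.map (s, y)) (R.x₁ s, R.y₁ s) t := by
  have h (a b : ℝ) : HasDerivAt (fun y => a + y * b) b t := by
    simpa using ((hasDerivAt_id t).mul_const b).const_add a
  exact (h (R.x₀ s) (R.x₁ s)).prodMk (h (R.y₀ s) (R.y₁ s))

theorem hasDerivAt_jac_right (s t : ℝ) :
    HasDerivAt (fun y => R.jac s y) (R.x₁' s * R.y₁ s - R.y₁' s * R.x₁ s) t := by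
  have h (a b : ℝ) : HasDerivAt (fun y => a + y * b) b t := by
    simpa using ((hasDerivAt_id t).mul_const b).const_add a
  exact ((h (R.x₀' s) (R.x₁' s)).mul_const _).sub ((h (R.y₀' s) (R.y₁' s)).mul_const _)

theorem jac_eq (s t : ℝ) : R.jac s t = (R.x₀' s * R.y₁ s - R.y₀' s * R.x₁ s) +
    (R.x₁' s * R.y₁ s - R.y₁' s * R.x₁ s) * t := by
  simp only [jac, dx, dy]; ring

theorem hasDerivAt_comp_map {g : ℝ × ℝ → ℝ} {z : ℝ → ℝ} {γ : ℝ → ℝ × ℝ} {a b r : ℝ}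
    (hg : DifferentiableAt ℝ g (γ r)) (hγ : HasDerivAt γ (a, b) r) (h : ∀ᶠ y in 𝓝 r, z y = g (γ y)) :
    HasDerivAt z (fderiv ℝ g (γ r) (1, 0) * a + fderiv ℝ g (γ r) (0, 1) * b) r := by
  have h1 := hg.hasFDerivAt.comp_hasDerivAt r hγ
  refine HasDerivAt.congr_of_eventuallyEq ?_ h
  convert! h1 using 1
  have : ((a, b) : ℝ × ℝ) = a • (1, 0) + b • (0, 1) := by simp
  rw [this, map_add, map_smul, map_smul]
  simp only [smul_eq_mul]; ring

/-- The derivative of a function of the form `(polynomial in t) / jac ^ M` along almost every line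
is given by a function of the same form. -/
theorem exists_polynomial_deriv (hD : R.Domain K T) {M : ℕ} {S : Finset ℝ} (hS : (S : Set ℝ) ⊆ K)
    (hrat : ∀ s ∈ R.I, ∀ t ∈ T, u s t = R.extend M S u s t)
    (hs : s ∈ R.I) (hK : ∀ τ ∈ K, DifferentiableAt ℝ (fun y => u y τ) s)
    (h₁ : DifferentiableAt ℝ R.x₀' s) (h₂ : DifferentiableAt ℝ R.x₁' s)
    (h₃ : DifferentiableAt ℝ R.y₀' s) (h₄ : DifferentiableAt ℝ R.y₁' s) :
    ∃ A ∈ degreeLT ℝ (S.card + 1), ∀ t ∈ T,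
      HasDerivAt (fun y => u y t) (A.eval t / R.jac s t ^ (M + 1)) s := by
  obtain ⟨j₀, j₁, hj⟩ : ∃ j₀ j₁ : ℝ, ∀ t, HasDerivAt (fun y => R.jac y t) (j₀ + j₁ * t) s := by
    have hx₁ := R.hasDerivAt_x₁ s hs
    have hy₁ := R.hasDerivAt_y₁ s hs
    refine ⟨deriv R.x₀' s * R.y₁ s + R.x₀' s * R.y₁' s -
        (deriv R.y₀' s * R.x₁ s + R.y₀' s * R.x₁' s),
      deriv R.x₁' s * R.y₁ s + R.x₁' s * R.y₁' s -
        (deriv R.y₁' s * R.x₁ s + R.y₁' s * R.x₁' s), fun t => ?_⟩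
    convert! ((h₁.hasDerivAt.add (h₂.hasDerivAt.const_mul t)).mul hy₁).sub
      ((h₃.hasDerivAt.add (h₄.hasDerivAt.const_mul t)).mul hx₁) using 1
    simp only [Pi.add_apply]
    ring
  have hc : ∀ τ ∈ K, HasDerivAt (fun y => R.jac y τ ^ M * u y τ)
      (deriv (fun y => R.jac y τ ^ M * u y τ) s) s := fun τ hτ =>
    (((hj τ).differentiableAt.pow M).mul (hK τ hτ)).hasDerivAt
  set c' : ℝ → ℝ := fun τ => deriv (fun y => R.jac y τ ^ M * u y τ) s
  set Q := Lagrange.interpolate S id fun τ => R.jac s τ ^ M * u s τ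
  refine ⟨(C (R.x₀' s * R.y₁ s - R.y₀' s * R.x₁ s) + C (R.x₁' s * R.y₁ s - R.y₁' s * R.x₁ s) * X)
    * Lagrange.interpolate S id c' - C (M : ℝ) * ((C j₀ + C j₁ * X) * Q),
    Submodule.sub_mem _ (linear_mul_mem_degreeLT (interpolate_id_mem_degreeLT _ _) _ _)
      (C_mul_mem_degreeLT (linear_mul_mem_degreeLT (interpolate_id_mem_degreeLT _ _) _ _) _),
    fun t ht => ?_⟩
  have hQ : HasDerivAt (fun y => (Lagrange.interpolate S id fun τ => R.jac y τ ^ M * u y τ).eval t)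
      ((Lagrange.interpolate S id c').eval t) s := by
    simp only [eval_interpolate_id]
    exact HasDerivAt.fun_sum fun τ hτ => (hc τ (hS hτ)).mul_const _
  convert! hasDerivAt_of_pow_mul_eq (M := M) ?_ (hj t) hQ (hD.jac_ne_zero s hs t ht) using 2
  · simp only [eval_sub, eval_mul, eval_add, eval_C, eval_X, ← jac_eq]
    ring
  · filter_upwards [eventually_mem_I hs] with y hy
    exact (congrArg (R.jac y t ^ M * ·) (hrat y hy t ht)).trans
      (pow_mul_extend (hD.jac_ne_zero y hy t ht))

theorem Admissible.exists_partial_derivatives (hD : R.Domain K T) (hu : R.Admissible K T u) :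
    ∃ u₁ u₂ : ℝ → ℝ → ℝ, R.Admissible K T u₁ ∧ R.Admissible K T u₂ ∧ ∀ s ∈ R.I, ∀ t ∈ T,
      HasDerivAt (fun y => u y t) (u₁ s t * R.dx s t + u₂ s t * R.dy s t) s ∧
      HasDerivAt (fun y => u s y) (u₁ s t * R.x₁ s + u₂ s t * R.y₁ s) t := by
  obtain ⟨g, hg⟩ := hu.smooth
  obtain ⟨M, S, hS, hrat⟩ := hu.exists_eq_extend hD
  obtain ⟨S', hS', hcard⟩ := hD.exists_nodes (S.card + 2)
  set G₁ : ℝ → ℝ → ℝ := fun s t => fderiv ℝ g (R.map (s, t)) (1, 0) with hG₁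
  set G₂ : ℝ → ℝ → ℝ := fun s t => fderiv ℝ g (R.map (s, t)) (0, 1) with hG₂
  have hfd (w : ℝ × ℝ) (s : ℝ) (hs : s ∈ R.I) (t : ℝ) (ht : t ∈ K) :
      ContDiffAt ℝ ∞ (fun z => fderiv ℝ g z w) (R.map (s, t)) :=
    ((hg s hs t ht).1.fderiv_right (m := ∞) (by simp)).clm_apply contDiffAt_const
  have hGc (w : ℝ × ℝ) (s : ℝ) (hs : s ∈ R.I) (t : ℝ) (ht : t ∈ K) :
      ContinuousAt (fun y => fderiv ℝ g (R.map (y, t)) w) s :=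
    (hfd w s hs t ht).continuousAt.comp_of_eq (f := fun y => R.map (y, t))
      (lipAt_map hs t).continuousAt rfl
  have hgd (s : ℝ) (hs : s ∈ R.I) (t : ℝ) (ht : t ∈ K) : DifferentiableAt ℝ g (R.map (s, t)) :=
    (hg s hs t ht).1.differentiableAt (by simp)
  have hds (s : ℝ) (hs : s ∈ R.I) (t : ℝ) (ht : t ∈ K) :
      HasDerivAt (fun y => u y t) (G₁ s t * R.dx s t + G₂ s t * R.dy s t) s :=
    hasDerivAt_comp_map (γ := fun y => R.map (y, t)) (hgd s hs t ht) (hasDerivAt_map_left hs t)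
      ((eventually_mem_I hs).mono fun y hy => (hg y hy t ht).2)
  have hdt (s : ℝ) (hs : s ∈ R.I) (t : ℝ) (ht : t ∈ K) :
      HasDerivAt (fun y => u s y) (G₁ s t * R.x₁ s + G₂ s t * R.y₁ s) t :=
    hasDerivAt_comp_map (γ := fun y => R.map (s, y)) (hgd s hs t ht) (hasDerivAt_map_right s t)
      ((hD.isOpen_left.eventually_mem ht).mono fun y hy => (hg s hs y hy).2)
  -- the derivative along the lines
  set Q : ℝ → ℝ[X] := fun s => Lagrange.interpolate S id fun τ => R.jac s τ ^ M * u s τ with hQ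
  set J₀ : ℝ → ℝ := fun s => R.x₀' s * R.y₁ s - R.y₀' s * R.x₁ s with hJ₀
  set J₁ : ℝ → ℝ := fun s => R.x₁' s * R.y₁ s - R.y₁' s * R.x₁ s with hJ₁
  set b : ℝ → ℝ → ℝ := fun s t =>
    (R.jac s t * (Q s).derivative.eval t - M * J₁ s * (Q s).eval t) / R.jac s t ^ (M + 1) with hb
  have hb' (s : ℝ) (hs : s ∈ R.I) (t : ℝ) (ht : t ∈ T) : HasDerivAt (fun y => u s y) (b s t) t := by
    refine hasDerivAt_of_pow_mul_eq ?_ (hasDerivAt_jac_right s t) ((Q s).hasDerivAt t)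
      (hD.jac_ne_zero s hs t ht)
    filter_upwards [hD.isOpen_right.mem_nhds ht] with y hy
    exact (congrArg (R.jac s y ^ M * ·) (hrat s hs y hy)).trans
      (pow_mul_extend (hD.jac_ne_zero s hs y hy))
  have hbc (t : ℝ) (ht : t ∈ T) : ContinuousOn (fun s => b s t) R.I := by
    intro s hs
    apply ContinuousAt.continuousWithinAt
    have hJc (t : ℝ) : ContinuousAt (fun s => R.jac s t) s := (lipAt_jac hs t).continuousAt
    have hcc (τ : ℝ) (hτ : τ ∈ S) : ContinuousAt (fun s => R.jac s τ ^ M * u s τ) s :=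
      ((hJc τ).pow M).mul (hu.lipAt_left hs (hS hτ)).continuousAt
    simp only [hb, hQ, eval_interpolate_id, eval_derivative_interpolate_id]
    refine ContinuousAt.div (((hJc t).mul ?_).sub (ContinuousAt.mul (continuousAt_const.mul ?_) ?_))
      ((hJc t).pow _) (pow_ne_zero _ (hD.jac_ne_zero s hs t ht))
    · exact tendsto_finsetSum _ fun τ hτ => (hcc τ hτ).mul continuousAt_const
    · exact ((R.lipAt_x₁' s hs).continuousAt.mul (lipAt_y₁ hs).continuousAt).sub
        ((R.lipAt_y₁' s hs).continuousAt.mul (lipAt_x₁ hs).continuousAt)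
    · exact tendsto_finsetSum _ fun τ hτ => (hcc τ hτ).mul continuousAt_const
  set u₁ := R.extend (M + 2) S' G₁ with hu₁
  set u₂ := R.extend (M + 2) S' G₂ with hu₂
  have hae : ∀ᵐ s, s ∈ R.I → (∀ t ∈ K, u₁ s t = G₁ s t ∧ u₂ s t = G₂ s t) ∧ ∀ t ∈ T,
      HasDerivAt (fun y => u y t) (u₁ s t * R.dx s t + u₂ s t * R.dy s t) s ∧
      b s t = u₁ s t * R.x₁ s + u₂ s t * R.y₁ s := by
    filter_upwards [ae_differentiableAt_of_lipAt R.lipAt_x₀', ae_differentiableAt_of_lipAt R.lipAt_x₁',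
      ae_differentiableAt_of_lipAt R.lipAt_y₀', ae_differentiableAt_of_lipAt R.lipAt_y₁']
      with s h₁ h₂ h₃ h₄ hs
    obtain ⟨A, hA, hA'⟩ := exists_polynomial_deriv hD hS hrat hs
      (fun τ hτ => (hds s hs τ hτ).differentiableAt) (h₁ hs) (h₂ hs) (h₃ hs) (h₄ hs)
    have hQd : Q s ∈ degreeLT ℝ S.card := interpolate_id_mem_degreeLT _ _
    have hQd' : (Q s).derivative ∈ degreeLT ℝ S.card := by
      rw [mem_degreeLT] at hQd ⊢
      exact (degree_derivative_le).trans_lt hQd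
    obtain ⟨B, hB, hB'⟩ : ∃ B ∈ degreeLT ℝ (S.card + 1), ∀ t, b s t = B.eval t / R.jac s t ^ (M + 1) :=
      ⟨(C (J₀ s) + C (J₁ s) * X) * (Q s).derivative - C (M * J₁ s) * Q s,
        Submodule.sub_mem _ (linear_mul_mem_degreeLT hQd' _ _)
          (degreeLT_mono (Nat.le_succ _) (C_mul_mem_degreeLT hQd _)), fun t => by
          simp [hb, jac_eq, hJ₀, hJ₁]⟩
    have hmono : degreeLT ℝ (S.card + 1) ≤ degreeLT ℝ (S.card + 2) := degreeLT_mono (Nat.le_succ _)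
    have hP₁ : C (R.y₁ s) * A - (C (R.y₀' s) + C (R.y₁' s) * X) * B ∈ degreeLT ℝ S'.card := by
      rw [hcard]
      exact Submodule.sub_mem _ (hmono (C_mul_mem_degreeLT hA _)) (linear_mul_mem_degreeLT hB _ _)
    have hP₂ : (C (R.x₀' s) + C (R.x₁' s) * X) * B - C (R.x₁ s) * A ∈ degreeLT ℝ S'.card := by
      rw [hcard]
      exact Submodule.sub_mem _ (linear_mul_mem_degreeLT hB _ _) (hmono (C_mul_mem_degreeLT hA _))
    have hAK (t : ℝ) (ht : t ∈ K) :
        A.eval t = R.jac s t ^ (M + 1) * (G₁ s t * R.dx s t + G₂ s t * R.dy s t) := by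
      have hJ := hD.jac_ne_zero s hs t (hD.subset ht)
      rw [← (hA' t (hD.subset ht)).unique (hds s hs t ht)]
      field_simp
    have hBK (t : ℝ) (ht : t ∈ K) :
        B.eval t = R.jac s t ^ (M + 1) * (G₁ s t * R.x₁ s + G₂ s t * R.y₁ s) := by
      have hJ := hD.jac_ne_zero s hs t (hD.subset ht)
      rw [← (hb' s hs t (hD.subset ht)).unique (hdt s hs t ht), hB']
      field_simp
    have e₁ (t : ℝ) (ht : t ∈ K) : (C (R.y₁ s) * A - (C (R.y₀' s) + C (R.y₁' s) * X) * B).eval t =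
        R.jac s t ^ (M + 2) * G₁ s t := by
      simp only [eval_sub, eval_mul, eval_add, eval_C, eval_X, hAK t ht, hBK t ht]
      rw [pow_succ _ (M + 1)]
      simp only [jac, dx, dy]
      ring
    have e₂ (t : ℝ) (ht : t ∈ K) : ((C (R.x₀' s) + C (R.x₁' s) * X) * B - C (R.x₁ s) * A).eval t =
        R.jac s t ^ (M + 2) * G₂ s t := by
      simp only [eval_sub, eval_mul, eval_add, eval_C, eval_X, hAK t ht, hBK t ht]
      rw [pow_succ _ (M + 1)]
      simp only [jac, dx, dy]
      ring
    have i₁ := eq_interpolate_id hP₁ fun τ hτ => e₁ τ (hS' hτ)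
    have i₂ := eq_interpolate_id hP₂ fun τ hτ => e₂ τ (hS' hτ)
    have f₁ (t : ℝ) : u₁ s t = (C (R.y₁ s) * A - (C (R.y₀' s) + C (R.y₁' s) * X) * B).eval t /
        R.jac s t ^ (M + 2) := by rw [i₁]; rfl
    have f₂ (t : ℝ) : u₂ s t = ((C (R.x₀' s) + C (R.x₁' s) * X) * B - C (R.x₁ s) * A).eval t /
        R.jac s t ^ (M + 2) := by rw [i₂]; rfl
    refine ⟨fun t ht => ?_, fun t ht => ?_⟩
    · have hJ := hD.jac_ne_zero s hs t (hD.subset ht)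
      rw [f₁, f₂, e₁ t ht, e₂ t ht]
      constructor <;> field_simp
    · have hJ := hD.jac_ne_zero s hs t ht
      rw [f₁, f₂]
      simp only [eval_sub, eval_mul, eval_add, eval_C, eval_X]
      constructor
      · convert! hA' t ht using 1
        field_simp
        simp only [jac, dx, dy]
        ring
      · rw [hB']
        field_simp
        simp only [jac, dx, dy]
        ring
  have hcont₁ (t : ℝ) (ht : t ∈ T) : ContinuousOn (fun s => u₁ s t) R.I := fun s hs =>
    ((continuousAt_extend hs (hD.jac_ne_zero s hs t ht) fun τ hτ =>
      hGc (1, 0) s hs τ (hS' hτ)).comp_of_eq (f := fun s => (s, t)) (by fun_prop)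
        rfl).continuousWithinAt
  have hcont₂ (t : ℝ) (ht : t ∈ T) : ContinuousOn (fun s => u₂ s t) R.I := fun s hs =>
    ((continuousAt_extend hs (hD.jac_ne_zero s hs t ht) fun τ hτ =>
      hGc (0, 1) s hs τ (hS' hτ)).comp_of_eq (f := fun s => (s, t)) (by fun_prop)
        rfl).continuousWithinAt
  have hae_eq {φ ψ : ℝ → ℝ} (hφ : ContinuousOn φ R.I) (hψ : ContinuousOn ψ R.I)
      (h : ∀ᵐ s, s ∈ R.I → φ s = ψ s) : EqOn φ ψ R.I :=
    Measure.eqOn_open_of_ae_eq ((ae_restrict_iff' R.isOpen_I.measurableSet).2 h) R.isOpen_I hφ hψ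
  have hadm {v G : ℝ → ℝ → ℝ} (w : ℝ × ℝ) (hG : G = fun s t => fderiv ℝ g (R.map (s, t)) w)
      (hv : v = R.extend (M + 2) S' G) (h : ∀ s ∈ R.I, ∀ t ∈ K, v s t = G s t) :
      R.Admissible K T v := by
    refine ⟨⟨M + 2, S'.card, fun s hs => ⟨_, interpolate_id_mem_degreeLT S'
      fun τ => R.jac s τ ^ (M + 2) * G s τ, fun t ht => ?_⟩⟩, _, fun s hs t ht =>
      ⟨hfd w s hs t ht, ?_⟩⟩
    · have hJ := hD.jac_ne_zero s hs t ht
      rw [hv, extend]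
      field_simp
    · rw [h s hs t ht, hG]
  have hx₁c : ContinuousOn R.x₁ R.I := fun s hs => (lipAt_x₁ hs).continuousAt.continuousWithinAt
  have hy₁c : ContinuousOn R.y₁ R.I := fun s hs => (lipAt_y₁ hs).continuousAt.continuousWithinAt
  have hdxc (t : ℝ) : ContinuousOn (fun s => R.dx s t) R.I := fun s hs =>
    ((continuousAt_dx hs t).comp_of_eq (f := fun s => (s, t)) (by fun_prop)
        rfl).continuousWithinAt
  have hdyc (t : ℝ) : ContinuousOn (fun s => R.dy s t) R.I := fun s hs =>
    ((continuousAt_dy hs t).comp_of_eq (f := fun s => (s, t)) (by fun_prop)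
        rfl).continuousWithinAt
  refine ⟨u₁, u₂, hadm (1, 0) hG₁ hu₁ fun s hs t ht => ?_, hadm (0, 1) hG₂ hu₂ fun s hs t ht => ?_,
    fun s hs t ht => ⟨?_, ?_⟩⟩
  · exact hae_eq (hcont₁ t (hD.subset ht))
      (fun s hs => (hGc (1, 0) s hs t ht).continuousWithinAt)
      (hae.mono fun s h hs => ((h hs).1 t ht).1) hs
  · exact hae_eq (hcont₂ t (hD.subset ht))
      (fun s hs => (hGc (0, 1) s hs t ht).continuousWithinAt)
      (hae.mono fun s h hs => ((h hs).1 t ht).2) hs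
  · exact hasDerivAt_of_ae_of_lipAt R.isOpen_I (fun s hs => hu.lipAt hD hs ht)
      (((hcont₁ t ht).mul (hdxc t)).add ((hcont₂ t ht).mul (hdyc t)))
      (hae.mono fun s h hs => ((h hs).2 t ht).1) hs
  · convert hb' s hs t ht using 1
    exact (hae_eq (hbc t ht) (((hcont₁ t ht).mul hx₁c).add ((hcont₂ t ht).mul hy₁c))
      (hae.mono fun s h hs => ((h hs).2 t ht).2) hs).symm

end PlanarRuling

theorem hasStrictFDerivAt_of_hasDerivAt {u a b : ℝ → ℝ → ℝ} {p : ℝ × ℝ}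
    (ds : ∀ᶠ q in 𝓝 p, HasDerivAt (fun y => u y q.2) (a q.1 q.2) q.1)
    (dt : ∀ᶠ q in 𝓝 p, HasDerivAt (fun y => u q.1 y) (b q.1 q.2) q.2)
    (ca : ContinuousAt (fun q : ℝ × ℝ => a q.1 q.2) p)
    (cb : ContinuousAt (fun q : ℝ × ℝ => b q.1 q.2) p) :
    HasStrictFDerivAt (fun q : ℝ × ℝ => u q.1 q.2)
      (a p.1 p.2 • ContinuousLinearMap.fst ℝ ℝ ℝ + b p.1 p.2 • ContinuousLinearMap.snd ℝ ℝ ℝ) p := by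
  have key (f : ℝ → ℝ) (f' x : ℝ) (h : HasDerivAt f f' x) :
      HasFDerivAt f (f' • ContinuousLinearMap.id ℝ ℝ) x := by
    convert! h.hasFDerivAt using 1
    ext; simp
  have := hasStrictFDerivAt_uncurry_coprod (f := u)
    (f₁ := fun s t => a s t • ContinuousLinearMap.id ℝ ℝ)
    (f₂ := fun s t => b s t • ContinuousLinearMap.id ℝ ℝ) (u := p)
    (ds.mono fun q h => key _ _ _ h) (dt.mono fun q h => key _ _ _ h)
    (ca.smul continuousAt_const) (cb.smul continuousAt_const)
  convert! this using 1

/-- The linear automorphism of the plane with matrix `!![a, b; c, d]`. -/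
theorem exists_continuousLinearEquiv {a b c d : ℝ} (h : a * d - c * b ≠ 0) :
    ∃ L : (ℝ × ℝ) ≃L[ℝ] ℝ × ℝ, (L : (ℝ × ℝ) →L[ℝ] ℝ × ℝ) =
      (a • ContinuousLinearMap.fst ℝ ℝ ℝ + b • ContinuousLinearMap.snd ℝ ℝ ℝ).prod
        (c • ContinuousLinearMap.fst ℝ ℝ ℝ + d • ContinuousLinearMap.snd ℝ ℝ ℝ) := by
  set D := a * d - c * b with hD
  refine ⟨ContinuousLinearEquiv.equivOfInverse
    ((a • ContinuousLinearMap.fst ℝ ℝ ℝ + b • ContinuousLinearMap.snd ℝ ℝ ℝ).prod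
      (c • ContinuousLinearMap.fst ℝ ℝ ℝ + d • ContinuousLinearMap.snd ℝ ℝ ℝ))
    (((d / D) • ContinuousLinearMap.fst ℝ ℝ ℝ + (-b / D) • ContinuousLinearMap.snd ℝ ℝ ℝ).prod
      ((-c / D) • ContinuousLinearMap.fst ℝ ℝ ℝ + (a / D) • ContinuousLinearMap.snd ℝ ℝ ℝ))
    (fun x => ?_) (fun x => ?_), rfl⟩
  all_goals
    ext <;> simp <;> field_simp <;> rw [hD] <;> ring

namespace PlanarRuling

variable {R : PlanarRuling} {K T : Set ℝ} {u : ℝ → ℝ → ℝ} {s t : ℝ}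

theorem hasStrictFDerivAt_map (hs : s ∈ R.I) (t : ℝ) : HasStrictFDerivAt R.map
    ((R.dx s t • ContinuousLinearMap.fst ℝ ℝ ℝ + R.x₁ s • ContinuousLinearMap.snd ℝ ℝ ℝ).prod
      (R.dy s t • ContinuousLinearMap.fst ℝ ℝ ℝ + R.y₁ s • ContinuousLinearMap.snd ℝ ℝ ℝ))
    (s, t) := by
  have hI : ∀ᶠ q : ℝ × ℝ in 𝓝 (s, t), q.1 ∈ R.I :=
    continuousAt_fst.eventually (eventually_mem_I hs)
  exact HasStrictFDerivAt.prodMk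
    (hasStrictFDerivAt_of_hasDerivAt (u := fun s t => R.x₀ s + t * R.x₁ s) (a := R.dx)
      (b := fun s _ => R.x₁ s)
      (hI.mono fun q hq => (hasDerivAt_map_left hq q.2).fst)
      (hI.mono fun q hq => (hasDerivAt_map_right q.1 q.2).fst)
      (continuousAt_dx hs t)
      ((lipAt_x₁ hs).continuousAt.comp_of_eq (f := Prod.fst) continuousAt_fst rfl))
    (hasStrictFDerivAt_of_hasDerivAt (u := fun s t => R.y₀ s + t * R.y₁ s) (a := R.dy)
      (b := fun s _ => R.y₁ s)
      (hI.mono fun q hq => (hasDerivAt_map_left hq q.2).snd)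
      (hI.mono fun q hq => (hasDerivAt_map_right q.1 q.2).snd)
      (continuousAt_dy hs t)
      ((lipAt_y₁ hs).continuousAt.comp_of_eq (f := Prod.fst) continuousAt_fst rfl))

/-- `R.map` is a local homeomorphism where its Jacobian does not vanish. -/
theorem exists_openPartialHomeomorph {O : Set (ℝ × ℝ)} (hO : IsOpen O) (hst : (s, t) ∈ O)
    (hs : s ∈ R.I) (hJ : R.jac s t ≠ 0) :
    ∃ e : OpenPartialHomeomorph (ℝ × ℝ) (ℝ × ℝ), (e : ℝ × ℝ → ℝ × ℝ) = R.map ∧ (s, t) ∈ e.source ∧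
      e.source ⊆ O := by
  obtain ⟨L, hL⟩ := exists_continuousLinearEquiv (a := R.dx s t) (b := R.x₁ s) (c := R.dy s t)
    (d := R.y₁ s) hJ
  have h := hasStrictFDerivAt_map hs t
  rw [← hL] at h
  refine ⟨(h.toOpenPartialHomeomorph R.map).restrOpen O hO, ?_, ?_, ?_⟩
  · simp
  · simp [h.mem_toOpenPartialHomeomorph_source, hst]
  · simp

theorem Admissible.contDiffOn_comp_symm (hD : R.Domain K T) (hu : R.Admissible K T u)
    {e : OpenPartialHomeomorph (ℝ × ℝ) (ℝ × ℝ)} (he : (e : ℝ × ℝ → ℝ × ℝ) = R.map)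
    (hsrc : e.source ⊆ R.I ×ˢ T) :
    ContDiffOn ℝ ∞ (fun z => u (e.symm z).1 (e.symm z).2) e.target := by
  rw [contDiffOn_infty]
  intro n
  induction n generalizing u with
  | zero =>
    rw [Nat.cast_zero, contDiffOn_zero]
    intro z hz
    have hm := hsrc (e.map_target hz)
    exact ((hu.continuousAt hD hm.1 hm.2).comp_of_eq (e.continuousAt_symm hz)
      rfl).continuousWithinAt
  | succ n ih =>
    obtain ⟨u₁, u₂, h₁, h₂, h⟩ := hu.exists_partial_derivatives hD
    rw [Nat.cast_succ, contDiffOn_succ_iff_hasFDerivWithinAt_of_uniqueDiffOn e.open_target.uniqueDiffOn]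
    refine ⟨by simp, fun z => u₁ (e.symm z).1 (e.symm z).2 • ContinuousLinearMap.fst ℝ ℝ ℝ +
      u₂ (e.symm z).1 (e.symm z).2 • ContinuousLinearMap.snd ℝ ℝ ℝ,
      ((ih h₁).smul contDiffOn_const).add ((ih h₂).smul contDiffOn_const), fun z hz => ?_⟩
    have hm := hsrc (e.map_target hz)
    set s := (e.symm z).1 with hs
    set t := (e.symm z).2 with ht
    have hst : e.symm z = (s, t) := rfl
    have hev : ∀ᶠ q : ℝ × ℝ in 𝓝 (s, t), q ∈ R.I ×ˢ T :=
      (R.isOpen_I.prod hD.isOpen_right).mem_nhds hm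
    obtain ⟨L, hL⟩ := exists_continuousLinearEquiv (a := R.dx s t) (b := R.x₁ s) (c := R.dy s t)
      (d := R.y₁ s) (hD.jac_ne_zero s hm.1 t hm.2)
    have hmap := (hasStrictFDerivAt_map hm.1 t).hasFDerivAt
    rw [← hL, ← he] at hmap
    have hsymm := e.hasFDerivAt_symm hz hmap
    have c₁ := h₁.continuousAt hD hm.1 hm.2
    have c₂ := h₂.continuousAt hD hm.1 hm.2
    have cx : ContinuousAt (fun q : ℝ × ℝ => R.x₁ q.1) (s, t) :=
      (lipAt_x₁ hm.1).continuousAt.comp_of_eq (f := Prod.fst) continuousAt_fst rfl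
    have cy : ContinuousAt (fun q : ℝ × ℝ => R.y₁ q.1) (s, t) :=
      (lipAt_y₁ hm.1).continuousAt.comp_of_eq (f := Prod.fst) continuousAt_fst rfl
    have hstrict := hasStrictFDerivAt_of_hasDerivAt (u := u) (p := (s, t))
      (a := fun s t => u₁ s t * R.dx s t + u₂ s t * R.dy s t)
      (b := fun s t => u₁ s t * R.x₁ s + u₂ s t * R.y₁ s)
      (hev.mono fun q hq => (h q.1 hq.1 q.2 hq.2).1) (hev.mono fun q hq => (h q.1 hq.1 q.2 hq.2).2)
      ((c₁.mul (continuousAt_dx hm.1 t)).add (c₂.mul (continuousAt_dy hm.1 t)))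
      ((c₁.mul cx).add (c₂.mul cy))
    have hfac : (u₁ s t * R.dx s t + u₂ s t * R.dy s t) • ContinuousLinearMap.fst ℝ ℝ ℝ +
        (u₁ s t * R.x₁ s + u₂ s t * R.y₁ s) • ContinuousLinearMap.snd ℝ ℝ ℝ =
        (u₁ s t • ContinuousLinearMap.fst ℝ ℝ ℝ + u₂ s t • ContinuousLinearMap.snd ℝ ℝ ℝ).comp
          (L : (ℝ × ℝ) →L[ℝ] ℝ × ℝ) := by
      rw [hL]
      ext <;> simp
    have hcomp := HasFDerivAt.comp z (hst ▸ hstrict.hasFDerivAt) hsymm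
    have hid : (L : (ℝ × ℝ) →L[ℝ] ℝ × ℝ).comp (L.symm : (ℝ × ℝ) →L[ℝ] ℝ × ℝ) =
        ContinuousLinearMap.id ℝ (ℝ × ℝ) := by ext <;> simp
    refine HasFDerivAt.hasFDerivWithinAt ?_
    convert! hcomp using 1
    refine Eq.trans ?_ (congrArg (fun A => A.comp (L.symm : (ℝ × ℝ) →L[ℝ] ℝ × ℝ)) hfac.symm)
    simp only [ContinuousLinearMap.comp_assoc, hid, ContinuousLinearMap.comp_id]
    rfl

end PlanarRuling

theorem crossProduct_apply_cyclic (A B : Fin 3 → ℝ) (i : Fin 3) :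
    crossProduct A B i = A (i + 1) * B (i + 2) - A (i + 2) * B (i + 1) := by
  fin_cases i <;> simp [cross_apply]

theorem linearMap_apply_cyclic (l : (Fin 3 → ℝ) →ₗ[ℝ] ℝ) (i : Fin 3) (x : Fin 3 → ℝ) :
    l x = x i * l (Pi.single i 1) + x (i + 1) * l (Pi.single (i + 1) 1) +
      x (i + 2) * l (Pi.single (i + 2) 1) := by
  rw [LinearMap.pi_apply_eq_sum_univ l x, Fin.sum_univ_three]
  have (j : Fin 3) : (fun k : Fin 3 => if j = k then (1 : ℝ) else 0) = Pi.single j 1 := by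
    ext k; simp [Pi.single_apply, eq_comm]
  simp only [this, smul_eq_mul]
  fin_cases i <;> simp <;> ring

/-- A plane spanned by two vectors whose projections to a coordinate plane are independent contains
no vector projecting to zero. -/
theorem eq_zero_of_linearMap_eq_zero {l : (Fin 3 → ℝ) →ₗ[ℝ] ℝ} (hl : l ≠ 0) {i : Fin 3}
    {A B w : Fin 3 → ℝ} (hA : l A = 0) (hB : l B = 0) (hAB : crossProduct A B i ≠ 0)
    (h₁ : w (i + 1) = 0) (h₂ : w (i + 2) = 0) (hw : l w = 0) : w = 0 := by
  rw [crossProduct_apply_cyclic] at hAB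
  rw [linearMap_apply_cyclic l i] at hA hB hw
  rw [h₁, h₂] at hw
  by_contra hne
  have hwi : w i ≠ 0 := by
    refine fun h => hne (funext fun j => ?_)
    fin_cases i <;> fin_cases j <;> assumption
  have e₀ : l (Pi.single i 1) = 0 := by simpa [hwi] using hw
  rw [e₀] at hA hB
  have e₁ : l (Pi.single (i + 1) 1) = 0 := by
    refine (mul_eq_zero.1 ?_).resolve_left hAB
    linear_combination B (i + 2) * hA - A (i + 2) * hB
  have e₂ : l (Pi.single (i + 2) 1) = 0 := by
    refine (mul_eq_zero.1 ?_).resolve_left hAB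
    linear_combination A (i + 1) * hB - B (i + 1) * hA
  refine hl (LinearMap.ext fun x => ?_)
  rw [linearMap_apply_cyclic l i, e₀, e₁, e₂]
  simp

/-- A smooth surface parametrized by an immersion `F` is locally the graph of a smooth function over
any coordinate plane to which it projects by an immersion. -/
theorem IsSmoothSurface.exists_smooth_graph {S : Set (Fin 3 → ℝ)} (hS : IsSmoothSurface S)
    {F Fs Ft : ℝ × ℝ → Fin 3 → ℝ} {p : ℝ × ℝ} {i : Fin 3} (hF : ∀ᶠ q in 𝓝 p, F q ∈ S)
    (hc : ContinuousAt F p)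
    (hFs : ∀ᶠ q in 𝓝 p, HasDerivAt (fun y => F (y, q.2)) (Fs q) q.1)
    (hFt : ∀ᶠ q in 𝓝 p, HasDerivAt (fun y => F (q.1, y)) (Ft q) q.2)
    (hN : ∀ᶠ q in 𝓝 p, crossProduct (Fs q) (Ft q) i ≠ 0) :
    ∃ g : ℝ × ℝ → ℝ, ∀ᶠ q in 𝓝 p,
      ContDiffAt ℝ ∞ g (F q (i + 1), F q (i + 2)) ∧ F q i = g (F q (i + 1), F q (i + 2)) := by
  obtain ⟨U, φ, ψ, hU, hpU, hφU, hφ, hψ, hψφ, hφψ, himg⟩ := hS (F p) hF.self_of_nhds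
  set h : (Fin 3 → ℝ) → ℝ := fun x => φ x 2 with hh
  have hhs (x : Fin 3 → ℝ) (hx : x ∈ U) : ContDiffAt ℝ ∞ h x :=
    (contDiffAt_pi.1 (hφ.contDiffAt (hU.mem_nhds hx))) 2
  have hhd (x : Fin 3 → ℝ) (hx : x ∈ U) : HasFDerivAt h (fderiv ℝ h x) x :=
    ((hhs x hx).differentiableAt (by simp)).hasFDerivAt
  have hne (x : Fin 3 → ℝ) (hx : x ∈ U) : (fderiv ℝ h x : (Fin 3 → ℝ) →ₗ[ℝ] ℝ) ≠ 0 := by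
    intro h0
    have hφx : φ '' U ∈ 𝓝 (φ x) := hφU.mem_nhds (mem_image_of_mem φ hx)
    have h1 : HasFDerivAt (fun y => h (ψ y)) ((fderiv ℝ h x).comp (fderiv ℝ ψ (φ x))) (φ x) :=
      HasFDerivAt.comp (g := h) (φ x) (by rw [hψφ x hx]; exact hhd x hx)
        ((hψ.contDiffAt hφx).differentiableAt (by simp)).hasFDerivAt
    have h2 : HasFDerivAt (fun y => h (ψ y))
        (ContinuousLinearMap.proj (R := ℝ) (φ := fun _ : Fin 3 => ℝ) 2) (φ x) :=
      (hasFDerivAt_apply 2 (φ x)).congr_of_eventuallyEq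
        (mem_of_superset hφx fun y hy => congrFun (hφψ y hy) 2)
    have h3 := DFunLike.congr_fun (h1.unique h2) (Pi.single 2 1)
    have h4 := LinearMap.congr_fun h0 (fderiv ℝ ψ (φ x) (Pi.single 2 1))
    simp only [ContinuousLinearMap.comp_apply, ContinuousLinearMap.coe_coe,
      LinearMap.zero_apply] at h3 h4
    simp [h4] at h3
  have hz : ∀ᶠ q in 𝓝 p, F q ∈ U ∧ h (F q) = 0 := by
    filter_upwards [hF, hc.eventually_mem (hU.mem_nhds hpU)] with q h₁ h₂
    have : φ (F q) ∈ φ '' (U ∩ S) := mem_image_of_mem φ ⟨h₂, h₁⟩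
    rw [himg] at this
    exact ⟨h₂, this.2 2 le_rfl⟩
  set H : (Fin 3 → ℝ) → (ℝ × ℝ) × ℝ := fun x => ((x (i + 1), x (i + 2)), h x) with hH
  have hHs (x : Fin 3 → ℝ) (hx : x ∈ U) : ContDiffAt ℝ ∞ H x :=
    ((contDiff_apply ℝ ℝ (i + 1)).contDiffAt.prodMk
      (contDiff_apply ℝ ℝ (i + 2)).contDiffAt).prodMk (hhs x hx)
  have hHd : ∀ᶠ q in 𝓝 p, ∃ L : (Fin 3 → ℝ) ≃L[ℝ] (ℝ × ℝ) × ℝ,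
      HasFDerivAt H (L : (Fin 3 → ℝ) →L[ℝ] (ℝ × ℝ) × ℝ) (F q) := by
    filter_upwards [hz.eventually_nhds, hFs, hFt, hN] with q hq hqs hqt hqN
    have hqU := hq.self_of_nhds.1
    set A : (Fin 3 → ℝ) →L[ℝ] (ℝ × ℝ) × ℝ := ((ContinuousLinearMap.proj (i + 1)).prod
      (ContinuousLinearMap.proj (i + 2))).prod (fderiv ℝ h (F q)) with hA
    have hd : HasFDerivAt H A (F q) :=
      ((hasFDerivAt_apply (i + 1) (F q)).prodMk (hasFDerivAt_apply (i + 2) (F q))).prodMk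
        (hhd _ hqU)
    have hs0 : fderiv ℝ h (F q) (Fs q) = 0 :=
      ((hhd _ hqU).comp_hasDerivAt (l := h) q.1 hqs).unique ((hasDerivAt_const q.1 0).congr_of_eventuallyEq
        (f₁ := fun y => h (F (y, q.2))) ((Continuous.prodMk_left q.2).continuousAt.eventually (hq.mono fun q h => h.2)))
    have ht0 : fderiv ℝ h (F q) (Ft q) = 0 :=
      ((hhd _ hqU).comp_hasDerivAt (l := h) q.2 hqt).unique ((hasDerivAt_const q.2 0).congr_of_eventuallyEq
        (f₁ := fun y => h (F (q.1, y))) ((Continuous.prodMk_right q.1).continuousAt.eventually (hq.mono fun q h => h.2)))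
    have hinj : Function.Injective (A : (Fin 3 → ℝ) →ₗ[ℝ] (ℝ × ℝ) × ℝ) := by
      rw [injective_iff_map_eq_zero]
      intro w hw
      simp only [hA, ContinuousLinearMap.coe_coe, ContinuousLinearMap.prod_apply,
        ContinuousLinearMap.proj_apply, Prod.mk_eq_zero] at hw
      exact eq_zero_of_linearMap_eq_zero (hne _ hqU) hs0 ht0 hqN hw.1.1 hw.1.2 hw.2
    refine ⟨(LinearMap.linearEquivOfInjective _ hinj (by simp)).toContinuousLinearEquiv, ?_⟩
    convert! hd using 1
  obtain ⟨L, hL⟩ := hHd.self_of_nhds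
  have hstrict : HasStrictFDerivAt H (L : (Fin 3 → ℝ) →L[ℝ] (ℝ × ℝ) × ℝ) (F p) :=
    (hHs _ hpU).hasStrictFDerivAt' hL (by simp)
  set e := hstrict.toOpenPartialHomeomorph H with he
  have hsrc : ∀ᶠ q in 𝓝 p, F q ∈ e.source :=
    hc.eventually_mem (e.open_source.mem_nhds hstrict.mem_toOpenPartialHomeomorph_source)
  refine ⟨fun z => e.symm (z, 0) i, ?_⟩
  filter_upwards [hz, hsrc, hHd] with q hq hqs ⟨L, hL⟩
  have hHq : H (F q) = ((F q (i + 1), F q (i + 2)), 0) := by rw [hH, ← hq.2]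
  have hsymm : e.symm (H (F q)) = F q := e.left_inv hqs
  have hcd : ContDiffAt ℝ ∞ e.symm (H (F q)) :=
    e.contDiffAt_symm (e.map_source hqs) (f₀' := L) (by rw [hsymm]; exact hL)
      (by rw [hsymm]; exact hHs _ hq.1)
  rw [hHq] at hcd hsymm
  refine ⟨?_, by rw [hsymm]⟩
  exact contDiffAt_pi.1 (hcd.comp (f := fun z : ℝ × ℝ => (z, (0 : ℝ))) _
    (contDiffAt_id.prodMk contDiffAt_const)) i

theorem exists_graph_chart {S O : Set (Fin 3 → ℝ)} {V : Set (ℝ × ℝ)} {f : ℝ × ℝ → ℝ} {i : Fin 3}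
    {p : Fin 3 → ℝ} (hV : IsOpen V) (hf : ContDiffOn ℝ ∞ f V) (hO : IsOpen O) (hpO : p ∈ O)
    (hpV : (p (i + 1), p (i + 2)) ∈ V)
    (hS : ∀ x ∈ O, (x (i + 1), x (i + 2)) ∈ V → (x ∈ S ↔ x i = f (x (i + 1), x (i + 2)))) :
    ∃ U : Set (Fin 3 → ℝ), ∃ φ ψ : (Fin 3 → ℝ) → (Fin 3 → ℝ),
      IsOpen U ∧ p ∈ U ∧ IsOpen (φ '' U) ∧
      ContDiffOn ℝ (⊤ : ℕ∞) φ U ∧ ContDiffOn ℝ (⊤ : ℕ∞) ψ (φ '' U) ∧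
      (∀ x ∈ U, ψ (φ x) = x) ∧ (∀ y ∈ φ '' U, φ (ψ y) = y) ∧
      φ '' (U ∩ S) = (φ '' U) ∩ {x | ∀ i : Fin 3, 2 ≤ (i : ℕ) → x i = 0} := by
  set φ : (Fin 3 → ℝ) → Fin 3 → ℝ :=
    fun x => ![x (i + 1), x (i + 2), x i - f (x (i + 1), x (i + 2))] with hφ
  set ψ : (Fin 3 → ℝ) → Fin 3 → ℝ := fun y j => ![y 2 + f (y 0, y 1), y 0, y 1] (j - i) with hψ
  have hψφ (x : Fin 3 → ℝ) : ψ (φ x) = x := by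
    ext j
    fin_cases i <;> fin_cases j <;> simp [hφ, hψ]
  have hφψ (y : Fin 3 → ℝ) : φ (ψ y) = y := by
    ext j
    fin_cases i <;> fin_cases j <;> simp [hφ, hψ]
  set U : Set (Fin 3 → ℝ) := {x | (x (i + 1), x (i + 2)) ∈ V} ∩ O with hU
  set W : Set (Fin 3 → ℝ) := {y | (y 0, y 1) ∈ V} with hW
  have hWo : IsOpen W := hV.preimage (by fun_prop)
  have hφc : ContDiffOn ℝ ∞ φ U := by
    have h1 : ContDiffOn ℝ ∞ (fun x : Fin 3 → ℝ => f (x (i + 1), x (i + 2))) U :=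
      hf.comp (t := V) (f := fun x : Fin 3 → ℝ => (x (i + 1), x (i + 2))) (by fun_prop)
        fun x hx => hx.1
    refine contDiffOn_pi.2 fun j => ?_
    fin_cases j
    · exact (contDiff_apply ℝ ℝ (i + 1)).contDiffOn
    · exact (contDiff_apply ℝ ℝ (i + 2)).contDiffOn
    · exact (contDiff_apply ℝ ℝ i).contDiffOn.sub h1
  have hψc : ContDiffOn ℝ ∞ ψ W := by
    have h1 : ContDiffOn ℝ ∞ (fun y : Fin 3 → ℝ => f (y 0, y 1)) W :=
      hf.comp (t := V) (f := fun y : Fin 3 → ℝ => (y 0, y 1)) (by fun_prop) fun y hy => hy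
    refine contDiffOn_pi.2 fun j => ?_
    simp only [hψ]
    generalize j - i = k
    fin_cases k
    · exact (contDiff_apply ℝ ℝ 2).contDiffOn.add h1
    · exact (contDiff_apply ℝ ℝ 0).contDiffOn
    · exact (contDiff_apply ℝ ℝ 1).contDiffOn
  have himg : φ '' U = W ∩ ψ ⁻¹' O := by
    ext y
    constructor
    · rintro ⟨x, hx, rfl⟩
      exact ⟨hx.1, by rw [mem_preimage, hψφ]; exact hx.2⟩
    · intro hy
      refine ⟨ψ y, ⟨?_, hy.2⟩, hφψ y⟩
      have h0 := congrFun (hφψ y) 0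
      have h1 := congrFun (hφψ y) 1
      change ψ y (i + 1) = y 0 at h0
      change ψ y (i + 2) = y 1 at h1
      change (ψ y (i + 1), ψ y (i + 2)) ∈ V
      rw [h0, h1]
      exact hy.1
  refine ⟨U, φ, ψ, (hV.preimage (by fun_prop)).inter hO, ⟨hpV, hpO⟩, ?_, hφc, ?_, fun x _ => hψφ x,
    fun y _ => hφψ y, ?_⟩
  · rw [himg]
    exact hψc.continuousOn.isOpen_inter_preimage hWo hO
  · rw [himg]
    exact hψc.mono inter_subset_left
  · have key (x : Fin 3 → ℝ) (hx : x ∈ U) :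
        x ∈ S ↔ φ x ∈ {x : Fin 3 → ℝ | ∀ i : Fin 3, 2 ≤ (i : ℕ) → x i = 0} := by
      rw [hS x hx.2 hx.1, ← sub_eq_zero]
      refine ⟨fun h j hj => ?_, fun h => h 2 le_rfl⟩
      obtain rfl : j = 2 := by omega
      exact h
    rw [← image_inter_preimage]
    congr 1
    ext x
    exact and_congr_right fun hx => key x hx

variable {β v β' v' : ℝ → Fin 3 → ℝ} {a b : ℝ}

theorem lipAt_coord {f : ℝ → Fin 3 → ℝ} (h : ∀ s ∈ Ioo a b, ∃ t ∈ nhdsWithin s (Ioo a b),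
    ∃ K : NNReal, LipschitzOnWith K f t) (j : Fin 3) : ∀ s ∈ Ioo a b, LipAt (fun y => f y j) s := by
  intro s hs
  obtain ⟨t, ht, C, hC⟩ := h s hs
  rw [isOpen_Ioo.nhdsWithin_eq hs] at ht
  exact ⟨_, t, ht, (LipschitzWith.eval j).comp_lipschitzOnWith hC⟩

/-- The projection of a ruled surface to the coordinate plane orthogonal to the `i`-th axis. -/
def coordRuling (I : Set ℝ) (hI : IsOpen I) (β v β' v' : ℝ → Fin 3 → ℝ) (i : Fin 3)
    (hβ : ∀ s ∈ I, HasDerivAt β (β' s) s) (hv : ∀ s ∈ I, HasDerivAt v (v' s) s)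
    (hβ' : ∀ j, ∀ s ∈ I, LipAt (fun y => β' y j) s)
    (hv' : ∀ j, ∀ s ∈ I, LipAt (fun y => v' y j) s) : PlanarRuling where
  I := I
  x₀ s := β s (i + 1)
  x₁ s := v s (i + 1)
  y₀ s := β s (i + 2)
  y₁ s := v s (i + 2)
  x₀' s := β' s (i + 1)
  x₁' s := v' s (i + 1)
  y₀' s := β' s (i + 2)
  y₁' s := v' s (i + 2)
  isOpen_I := hI
  hasDerivAt_x₀ s hs := hasDerivAt_pi.1 (hβ s hs) (i + 1)
  hasDerivAt_x₁ s hs := hasDerivAt_pi.1 (hv s hs) (i + 1)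
  hasDerivAt_y₀ s hs := hasDerivAt_pi.1 (hβ s hs) (i + 2)
  hasDerivAt_y₁ s hs := hasDerivAt_pi.1 (hv s hs) (i + 2)
  lipAt_x₀' := hβ' (i + 1)
  lipAt_x₁' := hv' (i + 1)
  lipAt_y₀' := hβ' (i + 2)
  lipAt_y₁' := hv' (i + 2)

end RuledSurface

open RuledSurface Filter Topology Polynomial in
/-- Smooth extension for ruled surfaces in `ℝ³`: if the `C^{1,1}` ruled surface
`Σ = F((a,b) × (c,d))`, `F(s,t) = β(s) + t • v(s)`, is an embedded surface
satisfying the immersion condition `(β'(s) + t v'(s)) × v(s) ≠ 0`, and the strip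
`F((a,b) × (ε₁,ε₂))` is a `C^∞` embedded surface, then the whole ruled surface
`Σ` is a `C^∞` embedded surface. -/
theorem ruled_surface_smooth_extension (a b c d : ℝ) (hab : a < b) (hcd : c < d)
    (β v β' v' : ℝ → (Fin 3 → ℝ))
    (hβ : ∀ s ∈ Ioo a b, HasDerivAt β (β' s) s)
    (hv : ∀ s ∈ Ioo a b, HasDerivAt v (v' s) s)
    (hβ'lip : ∀ s ∈ Ioo a b, ∃ t ∈ nhdsWithin s (Ioo a b),
      ∃ K : NNReal, LipschitzOnWith K β' t)
    (hv'lip : ∀ s ∈ Ioo a b, ∃ t ∈ nhdsWithin s (Ioo a b),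
      ∃ K : NNReal, LipschitzOnWith K v' t)
    (F : ℝ × ℝ → (Fin 3 → ℝ)) (hF : ∀ p : ℝ × ℝ, F p = β p.1 + p.2 • v p.1)
    (himm : ∀ s ∈ Ioo a b, ∀ t ∈ Ioo c d,
      crossProduct (β' s + t • v' s) (v s) ≠ 0)
    (hemb : Topology.IsEmbedding (fun q : (Ioo a b ×ˢ Ioo c d : Set (ℝ × ℝ)) => F q))
    (ε₁ ε₂ : ℝ) (hcε₁ : c ≤ ε₁) (hε₁ε₂ : ε₁ < ε₂) (hε₂d : ε₂ ≤ d)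
    (hsmooth : IsSmoothSurface (F '' (Ioo a b ×ˢ Ioo ε₁ ε₂))) :
    IsSmoothSurface (F '' (Ioo a b ×ˢ Ioo c d)) := by
  obtain rfl : F = fun p => β p.1 + p.2 • v p.1 := funext hF
  rintro _ ⟨⟨s, t⟩, ⟨hs : s ∈ Ioo a b, ht : t ∈ Ioo c d⟩, rfl⟩
  set F : ℝ × ℝ → Fin 3 → ℝ := fun p => β p.1 + p.2 • v p.1
  have hβ' := fun j => lipAt_coord hβ'lip j
  have hv' := fun j => lipAt_coord hv'lip j
  obtain ⟨i, hi⟩ := Function.ne_iff.1 (himm s hs t ht)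
  -- the projection of the surface along the `i`-th axis
  set R₀ := coordRuling (Ioo a b) isOpen_Ioo β v β' v' i hβ hv hβ' hv'
  have hjac (y τ : ℝ) : crossProduct (β' y + τ • v' y) (v y) i = R₀.jac y τ :=
    crossProduct_apply_cyclic _ _ i
  replace hi : R₀.jac s t ≠ 0 := by rwa [hjac] at hi
  obtain ⟨τ, hτ, hJτ⟩ : ∃ τ ∈ Ioo ε₁ ε₂, R₀.jac s τ ≠ 0 := by
    by_contra! h
    have h1 := h ((2 * ε₁ + ε₂) / 3) ⟨by linarith, by linarith⟩
    have h2 := h ((ε₁ + 2 * ε₂) / 3) ⟨by linarith, by linarith⟩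
    rw [PlanarRuling.jac_eq] at h1 h2
    have h3 : R₀.x₁' s * R₀.y₁ s - R₀.y₁' s * R₀.x₁ s = 0 := by
      refine (mul_eq_zero.1 ?_).resolve_right (sub_ne_zero.2 hε₁ε₂.ne')
      linear_combination 3 * (h2 - h1)
    rw [h3] at h1
    exact hi (by rw [PlanarRuling.jac_eq, h3]; linarith)
  have hds (y σ : ℝ) (hy : y ∈ Ioo a b) :
      HasDerivAt (fun z => F (z, σ)) (β' y + σ • v' y) y :=
    (hβ y hy).add ((hv y hy).const_smul σ)
  have hdt (y σ : ℝ) : HasDerivAt (fun z => F (y, z)) (v y) σ := by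
    have h := ((hasDerivAt_id σ).smul_const (v y)).const_add (β y)
    rwa [one_smul] at h
  have hFc : ContinuousAt F (s, τ) :=
    ((hβ s hs).continuousAt.comp_of_eq (f := Prod.fst) continuousAt_fst rfl).add
      (continuousAt_snd.smul
        ((hv s hs).continuousAt.comp_of_eq (f := Prod.fst) continuousAt_fst rfl))
  have hnhds (σ : ℝ) : ∀ᶠ q : ℝ × ℝ in 𝓝 (s, σ), q.1 ∈ Ioo a b :=
    continuousAt_fst.eventually (isOpen_Ioo.mem_nhds hs)
  have hJnhds (σ : ℝ) (hσ : R₀.jac s σ ≠ 0) : ∀ᶠ q : ℝ × ℝ in 𝓝 (s, σ), R₀.jac q.1 q.2 ≠ 0 :=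
    (PlanarRuling.continuousAt_jac (R := R₀) hs σ).eventually_ne hσ
  obtain ⟨g, hg⟩ := hsmooth.exists_smooth_graph (F := F) (p := (s, τ)) (i := i)
    (Fs := fun q => β' q.1 + q.2 • v' q.1) (Ft := fun q => v q.1)
    (by
      filter_upwards [(isOpen_Ioo.prod isOpen_Ioo).mem_nhds ⟨hs, hτ⟩] with q hq
      exact mem_image_of_mem F hq)
    hFc ((hnhds τ).mono fun q hq => hds q.1 q.2 hq) (Eventually.of_forall fun q => hdt q.1 q.2)
    ((hJnhds τ hJτ).mono fun q hq => by rwa [hjac])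
  obtain ⟨I₁, T₁, hI₁, hsI₁, hT₁, htT₁, h₁⟩ := mem_nhds_prod_iff'.1 (hJnhds t hi)
  obtain ⟨I₂, K, hI₂, hsI₂, hK, hτK, h₂⟩ := mem_nhds_prod_iff'.1 (hg.and (hJnhds τ hJτ))
  have hIab : Ioo a b ∩ (I₁ ∩ I₂) ⊆ Ioo a b := inter_subset_left
  set R := coordRuling (Ioo a b ∩ (I₁ ∩ I₂)) (isOpen_Ioo.inter (hI₁.inter hI₂)) β v β' v' i
    (fun y hy => hβ y hy.1) (fun y hy => hv y hy.1) (fun j y hy => hβ' j y hy.1)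
    (fun j y hy => hv' j y hy.1)
  have hD : R.Domain K (K ∪ T₁) :=
    { subset := subset_union_left
      isOpen_left := hK
      nonempty := ⟨τ, hτK⟩
      isOpen_right := hK.union hT₁
      jac_ne_zero := by
        rintro y hy σ (hσ | hσ)
        · exact (h₂ (mk_mem_prod hy.2.2 hσ)).2
        · exact h₁ (mk_mem_prod hy.2.1 hσ) }
  have hmap (q : ℝ × ℝ) : R.map q = (F q (i + 1), F q (i + 2)) := rfl
  have hu : R.Admissible K (K ∪ T₁) fun y σ => F (y, σ) i :=
    { rational := ⟨0, 2, fun y _ => ⟨C (v y i) * X + C (β y i),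
        mem_degreeLT.2 (by exact_mod_cast degree_linear_lt), fun σ _ => by simp [F]; ring⟩⟩
      smooth := ⟨g, fun y hy σ hσ => (h₂ (mk_mem_prod hy.2.2 hσ)).1⟩ }
  obtain ⟨e, he, hste, hsrc⟩ := PlanarRuling.exists_openPartialHomeomorph (R := R) (s := s) (t := t)
    (R.isOpen_I.prod (hT₁.inter isOpen_Ioo)) ⟨⟨hs, hsI₁, hsI₂⟩, htT₁, ht⟩ ⟨hs, hsI₁, hsI₂⟩ hi
  have hf := hu.contDiffOn_comp_symm hD he
    (hsrc.trans (prod_mono_right (inter_subset_left.trans subset_union_right)))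
  obtain ⟨O, hO, hOe⟩ := hemb.isInducing.isOpen_iff.1 (e.open_source.preimage continuous_subtype_val)
  have hmemO (q : ℝ × ℝ) (hq : q ∈ Ioo a b ×ˢ Ioo c d) : F q ∈ O ↔ q ∈ e.source :=
    Set.ext_iff.1 hOe ⟨q, hq⟩
  refine exists_graph_chart (i := i) e.open_target hf hO ((hmemO _ ⟨hs, ht⟩).2 hste) ?_ fun x hxO hx => ?_
  · rw [← hmap, ← he]
    exact e.map_source hste
  · constructor
    · rintro ⟨q, hq, rfl⟩
      rw [← hmap, ← he, e.left_inv ((hmemO q hq).1 hxO)]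
    · intro hxi
      have hq := e.map_target hx
      have hinv := e.right_inv hx
      rw [he, hmap, Prod.mk.injEq] at hinv
      refine ⟨_, ⟨(hsrc hq).1.1, (hsrc hq).2.2⟩, funext fun j => ?_⟩
      have hj : j = i ∨ j = i + 1 ∨ j = i + 2 := by omega
      rcases hj with rfl | rfl | rfl
      exacts [hxi.symm, hinv.1, hinv.2]
end

section
/- Let k ≥ 1, let B ⊆ ℝ^{k-1} be an open set, let c < d be real numbers, and let h : B → ℝⁿ and v : B → ℝⁿ be C¹ maps with locally Lipschitz derivatives such that ‖v(x)‖ = 1 for all x ∈ B. Define F : B × (c,d) → ℝⁿ by F(x,t) = h(x) + t·v(x), and set Σ = F(B × (c,d)). Assume that the (total) derivative of F is injective at every point of B × (c,d), and that F is a homeomorphism from B × (c,d) onto Σ (with the subspace topology from ℝⁿ). If there exist ε₁, ε₂ with c ≤ ε₁ < ε₂ ≤ d such that F(B × (ε₁,ε₂)) is a C^∞ embedded k-dimensional submanifold of ℝⁿ, then the whole ruled set Σ is a C^∞ embedded k-dimensional submanifold of ℝⁿ. -/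
open Set

/-- `S ⊆ ℝⁿ` is a `C^∞` embedded `k`-dimensional submanifold of `ℝⁿ`: every point
of `S` has an open neighborhood `U` in `ℝⁿ` and a `C^∞` diffeomorphism `φ` from `U`
onto an open subset of `ℝⁿ` with `φ(U ∩ S) = φ(U) ∩ (ℝᵏ × {0})`. -/
def IsSmoothSubmanifold (n k : ℕ) (S : Set (EuclideanSpace ℝ (Fin n))) : Prop :=
  ∀ p ∈ S, ∃ U : Set (EuclideanSpace ℝ (Fin n)),
    ∃ φ ψ : EuclideanSpace ℝ (Fin n) → EuclideanSpace ℝ (Fin n),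
      IsOpen U ∧ p ∈ U ∧ IsOpen (φ '' U) ∧
      ContDiffOn ℝ (⊤ : ℕ∞) φ U ∧ ContDiffOn ℝ (⊤ : ℕ∞) ψ (φ '' U) ∧
      (∀ x ∈ U, ψ (φ x) = x) ∧ (∀ y ∈ φ '' U, φ (ψ y) = y) ∧
      φ '' (U ∩ S) = (φ '' U) ∩ {x | ∀ i : Fin n, k ≤ (i : ℕ) → x i = 0}

open Filter Topology Polynomial

section LinePolynomial

variable {T Y Z W : Type*} [TopologicalSpace T]
  [NormedAddCommGroup Y] [NormedSpace ℝ Y] [NormedAddCommGroup Z] [NormedSpace ℝ Z]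
  [NormedAddCommGroup W] [NormedSpace ℝ W]

/-- Functions `f (x, t)` that are polynomial in `t`, with coefficients continuous in `x ∈ V`. -/
def IsLinePoly (V : Set T) (f : T × ℝ → Y) : Prop :=
  ∃ (ι : Type) (_ : Fintype ι) (p : ι → ℝ[X]) (a : ι → T → Y),
    (∀ i, ContinuousOn (a i) V) ∧ ∀ x ∈ V, ∀ t, f (x, t) = ∑ i, (p i).eval t • a i x

namespace IsLinePoly

variable {V : Set T} {f g : T × ℝ → Y}

theorem congr (hf : IsLinePoly V f) (hfg : ∀ x ∈ V, ∀ t, g (x, t) = f (x, t)) :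
    IsLinePoly V g := by
  obtain ⟨ι, _, p, a, ha, hfa⟩ := hf
  exact ⟨ι, _, p, a, ha, fun x hx t ↦ (hfg x hx t).trans (hfa x hx t)⟩

theorem eval_smul (p : ℝ[X]) {a : T → Y} (ha : ContinuousOn a V) :
    IsLinePoly V fun z ↦ p.eval z.2 • a z.1 :=
  ⟨Unit, inferInstance, fun _ ↦ p, fun _ ↦ a, fun _ ↦ ha, by simp⟩

theorem of_continuousOn {a : T → Y} (ha : ContinuousOn a V) : IsLinePoly V fun z ↦ a z.1 := by
  simpa using eval_smul 1 ha

theorem const (y : Y) : IsLinePoly V fun _ : T × ℝ ↦ y :=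
  of_continuousOn (a := fun _ ↦ y) continuousOn_const

theorem add (hf : IsLinePoly V f) (hg : IsLinePoly V g) : IsLinePoly V fun z ↦ f z + g z := by
  obtain ⟨ι, _, p, a, ha, hfa⟩ := hf
  obtain ⟨κ, _, r, b, hb, hgb⟩ := hg
  refine ⟨ι ⊕ κ, inferInstance, Sum.elim p r, Sum.elim a b, ?_, fun x hx t ↦ ?_⟩
  · rintro (i | i)
    exacts [ha i, hb i]
  · simp [hfa x hx, hgb x hx]

theorem clm_apply (Λ : Y →L[ℝ] Z) (hf : IsLinePoly V f) : IsLinePoly V fun z ↦ Λ (f z) := by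
  obtain ⟨ι, _, p, a, ha, hfa⟩ := hf
  exact ⟨ι, inferInstance, p, fun i x ↦ Λ (a i x),
    fun i ↦ Λ.continuous.comp_continuousOn (ha i), fun x hx t ↦ by simp [hfa x hx]⟩

theorem bilin (Λ : Y →L[ℝ] Z →L[ℝ] W) {g : T × ℝ → Z} (hf : IsLinePoly V f)
    (hg : IsLinePoly V g) : IsLinePoly V fun z ↦ Λ (f z) (g z) := by
  obtain ⟨ι, _, p, a, ha, hfa⟩ := hf
  obtain ⟨κ, _, r, b, hb, hgb⟩ := hg
  refine ⟨ι × κ, inferInstance, fun i ↦ p i.1 * r i.2, fun i x ↦ Λ (a i.1 x) (b i.2 x),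
    fun i ↦ ?_, fun x hx t ↦ ?_⟩
  · exact (Λ.continuous.comp_continuousOn (ha i.1)).clm_apply (hb i.2)
  · simp only [hfa x hx, hgb x hx, map_sum, map_smul, sum_apply, smul_apply,
      Fintype.sum_prod_type, eval_mul, Finset.smul_sum, smul_smul]
    rw [Finset.sum_comm]
    simp only [mul_comm]

theorem smul {q : T × ℝ → ℝ} (hq : IsLinePoly V q) (hf : IsLinePoly V f) :
    IsLinePoly V fun z ↦ q z • f z :=
  bilin (ContinuousLinearMap.lsmul ℝ ℝ) hq hf

theorem mul {q r : T × ℝ → ℝ} (hq : IsLinePoly V q) (hr : IsLinePoly V r) :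
    IsLinePoly V fun z ↦ q z * r z :=
  hq.smul hr

theorem sub (hf : IsLinePoly V f) (hg : IsLinePoly V g) : IsLinePoly V fun z ↦ f z - g z := by
  simpa [sub_eq_add_neg] using hf.add ((const (-1 : ℝ)).smul hg)

theorem sum {κ : Type*} (s : Finset κ) {f : κ → T × ℝ → Y} (hf : ∀ i ∈ s, IsLinePoly V (f i)) :
    IsLinePoly V fun z ↦ ∑ i ∈ s, f i z := by
  classical
  induction s using Finset.induction_on with
  | empty => simpa using const (V := V) (0 : Y)
  | insert i s hi ih =>
    simp only [Finset.sum_insert hi]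
    exact (hf i (by simp)).add (ih fun j hj ↦ hf j (by simp [hj]))

theorem prod {κ : Type*} (s : Finset κ) {f : κ → T × ℝ → ℝ} (hf : ∀ i ∈ s, IsLinePoly V (f i)) :
    IsLinePoly V fun z ↦ ∏ i ∈ s, f i z := by
  classical
  induction s using Finset.induction_on with
  | empty => simpa using const (V := V) (1 : ℝ)
  | insert i s hi ih =>
    simp only [Finset.prod_insert hi]
    exact (hf i (by simp)).mul (ih fun j hj ↦ hf j (by simp [hj]))

theorem comp {T' : Type*} [TopologicalSpace T'] {V' : Set T'} {φ : T' → T} (hf : IsLinePoly V f)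
    (hφ : ContinuousOn φ V') (hm : MapsTo φ V' V) : IsLinePoly V' fun z ↦ f (φ z.1, z.2) := by
  obtain ⟨ι, _, p, a, ha, hfa⟩ := hf
  exact ⟨ι, _, p, fun i x ↦ a i (φ x), fun i ↦ (ha i).comp hφ hm,
    fun x hx t ↦ hfa _ (hm hx) t⟩

theorem mono {V' : Set T} (hf : IsLinePoly V f) (h : V' ⊆ V) : IsLinePoly V' f :=
  hf.comp (φ := id) continuousOn_id h

theorem continuousOn (hf : IsLinePoly V f) : ContinuousOn f (V ×ˢ univ) := by
  obtain ⟨ι, _, p, a, ha, hfa⟩ := hf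
  have : ContinuousOn (fun z : T × ℝ ↦ ∑ i, (p i).eval z.2 • a i z.1) (V ×ˢ univ) :=
    continuousOn_finsetSum _ fun i _ ↦
      ((p i).continuous.comp continuous_snd).continuousOn.smul
        ((ha i).comp continuousOn_fst fun z hz ↦ hz.1)
  exact this.congr fun z hz ↦ hfa z.1 hz.1 z.2

theorem continuousAt (hV : IsOpen V) (hf : IsLinePoly V f) {z : T × ℝ}
    (hz : z.1 ∈ V) : ContinuousAt f z :=
  hf.continuousOn.continuousAt ((hV.prod isOpen_univ).mem_nhds ⟨hz, mem_univ _⟩)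

theorem exists_hasDerivAt (hf : IsLinePoly V f) : ∃ f' : T × ℝ → Y, IsLinePoly V f' ∧
    ∀ x ∈ V, ∀ t, HasDerivAt (fun t ↦ f (x, t)) (f' (x, t)) t := by
  obtain ⟨ι, _, p, a, ha, hfa⟩ := hf
  refine ⟨fun z ↦ ∑ i, (derivative (p i)).eval z.2 • a i z.1,
    ⟨ι, _, fun i ↦ derivative (p i), a, ha, fun _ _ _ ↦ rfl⟩, fun x hx t ↦ ?_⟩
  simp only [hfa x hx]
  exact HasDerivAt.fun_sum fun i _ ↦ ((p i).hasDerivAt t).smul_const (a i x)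

/-- Lagrange interpolation: a line polynomial is determined by its values on finitely many
slices, which may be taken from any given infinite set. -/
theorem exists_interpolation (hf : IsLinePoly V f) {J : Set ℝ} (hJ : J.Infinite) :
    ∃ (S : Finset ℝ) (l : ℝ → ℝ[X]), (S : Set ℝ) ⊆ J ∧
      ∀ x ∈ V, ∀ t, f (x, t) = ∑ s ∈ S, (l s).eval t • f (x, s) := by
  obtain ⟨ι, _, p, a, ha, hfa⟩ := hf
  obtain ⟨S, hS, hcard⟩ := hJ.exists_subset_card_eq
    ((Finset.univ.sup fun i ↦ (p i).natDegree) + 1)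
  refine ⟨S, Lagrange.basis S id, hS, fun x hx t ↦ ?_⟩
  have key (i : ι) : (p i).eval t = ∑ s ∈ S, (Lagrange.basis S id s).eval t * (p i).eval s := by
    have hdeg : (p i).degree < (S.card : WithBot ℕ) := by
      refine degree_le_natDegree.trans_lt ?_
      rw [hcard]
      exact_mod_cast Nat.lt_succ_of_le
        (Finset.le_sup (f := fun i ↦ (p i).natDegree) (Finset.mem_univ i))
    conv_lhs => rw [Lagrange.eq_interpolate (v := id) (injOn_id _) hdeg]
    simp [Lagrange.interpolate_apply, eval_finsetSum, mul_comm]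
  simp only [hfa x hx, key, Finset.sum_smul, Finset.smul_sum, smul_smul]
  exact Finset.sum_comm

/-- A line polynomial that is nonzero at one point of a line has a nonzero value on every
infinite subset of that line. -/
theorem exists_ne_zero {q : T × ℝ → ℝ} (hq : IsLinePoly V q) {x : T} (hx : x ∈ V) {t : ℝ}
    (ht : q (x, t) ≠ 0) {J : Set ℝ} (hJ : J.Infinite) : ∃ s ∈ J, q (x, s) ≠ 0 := by
  obtain ⟨S, l, hS, hl⟩ := hq.exists_interpolation hJ
  by_contra! h
  exact ht (by rw [hl x hx]; exact Finset.sum_eq_zero fun s hs ↦ by simp [h s (hS hs)])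

end IsLinePoly

end LinePolynomial

section RationalAlongLines

variable {E Y X : Type*} [NormedAddCommGroup E] [NormedSpace ℝ E]
  [NormedAddCommGroup Y] [NormedSpace ℝ Y] [NormedAddCommGroup X] [NormedSpace ℝ X]

/-- If `H` vanishes at `z`, then `c • H` is differentiable at `z` as soon as `H` is, for any `c`
continuous at `z`. -/
theorem HasFDerivAt.continuousAt_smul_of_eq_zero {c : X → ℝ} {H : X → Y} {H' : X →L[ℝ] Y} {z : X}
    (hH : HasFDerivAt H H' z) (hz : H z = 0) (hc : ContinuousAt c z) :
    HasFDerivAt (fun w ↦ c w • H w) (c z • H') z := by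
  rw [hasFDerivAt_iff_isLittleO] at hH ⊢
  simp only [hz, sub_zero, smul_zero] at hH ⊢
  have h1 : (fun w ↦ c w • (H w - H' (w - z))) =o[𝓝 z] fun w ↦ w - z := by
    simpa using (hc.tendsto.isBigO_one ℝ).smul_isLittleO hH
  have h2 : (fun w ↦ (c w - c z) • H' (w - z)) =o[𝓝 z] fun w ↦ w - z := by
    have : (fun w ↦ c w - c z) =o[𝓝 z] fun _ ↦ (1 : ℝ) := by
      rw [Asymptotics.isLittleO_one_iff]
      simpa using hc.tendsto.sub_const (c z)
    simpa using this.smul_isBigO (H'.isBigO_sub (𝓝 z) z)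
  refine (h1.add h2).congr_left fun w ↦ ?_
  simp only [smul_sub, sub_smul, smul_apply]
  abel

/-- Extrapolation of differentiability along lines: a function rational along the lines `{x} × ℝ`
which is continuously differentiable over infinitely many slices is differentiable everywhere, with
a derivative that is again rational along lines. -/
theorem exists_hasFDerivAt_of_rational {V : Set E} (hV : IsOpen V) {J J₁ : Set ℝ} (hJ : IsOpen J)
    (hJ₁ : J₁.Infinite) (hJJ : J₁ ⊆ J) {G P : E × ℝ → Y} {q : E × ℝ → ℝ}
    (hq : IsLinePoly V q) (hP : IsLinePoly V P) (hq0 : ∀ z ∈ V ×ˢ J, q z ≠ 0)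
    (hG : ∀ z ∈ V ×ˢ J, q z • G z = P z)
    (hdiff : ∀ z ∈ V ×ˢ J₁, DifferentiableAt ℝ G z)
    (hcont : ∀ z ∈ V ×ˢ J₁, ContinuousAt (fderiv ℝ G) z) :
    ∃ R : E × ℝ → (E × ℝ →L[ℝ] Y), IsLinePoly V R ∧
      ∀ z ∈ V ×ˢ J, HasFDerivAt G ((q z * q z)⁻¹ • R z) z := by
  obtain ⟨q', hq'poly, hq'⟩ := hq.exists_hasDerivAt
  obtain ⟨P', hP'poly, hP'⟩ := hP.exists_hasDerivAt
  have hcross : IsLinePoly (V ×ˢ V) fun z : (E × E) × ℝ ↦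
      q (z.1.1, z.2) • P (z.1.2, z.2) - q (z.1.2, z.2) • P (z.1.1, z.2) :=
    ((hq.comp continuousOn_fst fun z hz ↦ hz.1).smul
      (hP.comp continuousOn_snd fun z hz ↦ hz.2)).sub
    ((hq.comp continuousOn_snd fun z hz ↦ hz.2).smul
      (hP.comp continuousOn_fst fun z hz ↦ hz.1))
  obtain ⟨S, l, hS, hl⟩ := hcross.exists_interpolation hJ₁
  have hGq : ∀ z ∈ V ×ˢ J, G z = (q z)⁻¹ • P z := fun z hz ↦ by
    rw [← hG z hz, smul_smul, inv_mul_cancel₀ (hq0 z hz), one_smul]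
  let D : E → ℝ → (E →L[ℝ] Y) := fun x s ↦
    (fderiv ℝ G (x, s)).comp (ContinuousLinearMap.inl ℝ E ℝ)
  have hslice : ∀ x ∈ V, ∀ s ∈ S, HasFDerivAt (fun x' ↦ G (x', s)) (D x s) x := fun x hx s hs ↦
    (hdiff (x, s) ⟨hx, hS hs⟩).hasFDerivAt.comp x (hasFDerivAt_prodMk_left x s)
  let Q : E → ℝ → E × ℝ → ℝ := fun x s z ↦
    (l s).eval z.2 * (q (x, s) * (q (x, z.2))⁻¹ * (q (z.1, s) * (q z)⁻¹))
  have hdecomp : ∀ x ∈ V, ∀ z ∈ V ×ˢ J,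
      G z = (q (x, z.2))⁻¹ • P (x, z.2) + ∑ s ∈ S, Q x s z • (G (z.1, s) - G (x, s)) := by
    rintro x hx ⟨y, t⟩ ⟨hy, ht⟩
    have h1 := hl (x, y) ⟨hx, hy⟩ t
    have hx0 := hq0 (x, t) ⟨hx, ht⟩
    have hy0 := hq0 (y, t) ⟨hy, ht⟩
    have h2 : ∀ s ∈ S, q (x, s) • P (y, s) - q (y, s) • P (x, s)
        = (q (x, s) * q (y, s)) • (G (y, s) - G (x, s)) := fun s hs ↦ by
      rw [← hG (x, s) ⟨hx, hJJ (hS hs)⟩, ← hG (y, s) ⟨hy, hJJ (hS hs)⟩]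
      module
    have h3 : ∑ s ∈ S, Q x s (y, t) • (G (y, s) - G (x, s)) =
        ((q (x, t))⁻¹ * (q (y, t))⁻¹) • (q (x, t) • P (y, t) - q (y, t) • P (x, t)) := by
      simp only at h1
      rw [h1, Finset.smul_sum]
      refine Finset.sum_congr rfl fun s hs ↦ ?_
      rw [h2 s hs]
      simp only [Q, smul_smul]
      congr 1
      ring
    rw [h3, hGq (y, t) ⟨hy, ht⟩, smul_sub, smul_smul, smul_smul]
    have e1 : (q (x, t))⁻¹ * (q (y, t))⁻¹ * q (x, t) = (q (y, t))⁻¹ := by field_simp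
    have e2 : (q (x, t))⁻¹ * (q (y, t))⁻¹ * q (y, t) = (q (x, t))⁻¹ := by field_simp
    rw [e1, e2]
    abel
  let R : E × ℝ → (E × ℝ →L[ℝ] Y) := fun z ↦
    (ContinuousLinearMap.snd ℝ E ℝ).smulRight (q z • P' z - q' z • P z) +
    ∑ s ∈ S, (l s).eval z.2 •
      ((q (z.1, s) * q (z.1, s)) • (D z.1 s).comp (ContinuousLinearMap.fst ℝ E ℝ))
  refine ⟨R, ?_, ?_⟩
  · refine IsLinePoly.add ?_ (IsLinePoly.sum S fun s hs ↦ IsLinePoly.eval_smul (l s)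
      (a := fun x ↦ (q (x, s) * q (x, s)) • (D x s).comp (ContinuousLinearMap.fst ℝ E ℝ)) ?_)
    · exact ((hq.smul hP'poly).sub (hq'poly.smul hP)).clm_apply
        (ContinuousLinearMap.smulRightL ℝ (E × ℝ) Y (ContinuousLinearMap.snd ℝ E ℝ))
    · have hm : MapsTo (fun x : E ↦ (x, s)) V (V ×ˢ univ) := fun x hx ↦ ⟨hx, mem_univ _⟩
      have hqs : ContinuousOn (fun x ↦ q (x, s)) V :=
        hq.continuousOn.comp (by fun_prop) hm
      have hD : ContinuousOn (fun x ↦ fderiv ℝ G (x, s)) V := fun x hx ↦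
        (ContinuousAt.comp (f := fun x : E ↦ (x, s)) (hcont (x, s) ⟨hx, hS hs⟩)
          (by fun_prop)).continuousWithinAt
      exact (hqs.mul hqs).smul ((hD.clm_comp continuousOn_const).clm_comp continuousOn_const)
  · rintro ⟨x, t⟩ hz
    obtain ⟨hx, ht⟩ := hz
    have hx0 := hq0 (x, t) ⟨hx, ht⟩
    have hline : HasFDerivAt (fun z : E × ℝ ↦ (q (x, z.2))⁻¹ • P (x, z.2))
        ((ContinuousLinearMap.snd ℝ E ℝ).smulRight ((q (x, t))⁻¹ • P' (x, t) +
          (-q' (x, t) / q (x, t) ^ 2) • P (x, t))) (x, t) := by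
      have h1 := ((hq' x hx t).fun_inv hx0).fun_smul (hP' x hx t)
      have h2 := h1.hasFDerivAt.comp (x, t) (hasFDerivAt_snd (𝕜 := ℝ) (p := (x, t)))
      refine h2.congr_fderiv ?_
      ext <;> simp
    have hsum : HasFDerivAt (fun z : E × ℝ ↦ ∑ s ∈ S, Q x s z • (G (z.1, s) - G (x, s)))
        (∑ s ∈ S, Q x s (x, t) • (D x s).comp (ContinuousLinearMap.fst ℝ E ℝ)) (x, t) := by
      refine HasFDerivAt.fun_sum fun s hs ↦ ?_
      refine HasFDerivAt.continuousAt_smul_of_eq_zero ?_ (by simp) ?_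
      · exact ((hslice x hx s hs).comp (x, t) (hasFDerivAt_fst (𝕜 := ℝ) (p := (x, t)))).sub_const _
      · have c1 : ContinuousAt (fun z : E × ℝ ↦ q (x, z.2)) (x, t) :=
          ContinuousAt.comp (f := fun z : E × ℝ ↦ (x, z.2)) (hq.continuousAt hV hx) (by fun_prop)
        have c2 : ContinuousAt (fun z : E × ℝ ↦ q (z.1, s)) (x, t) :=
          ContinuousAt.comp (f := fun z : E × ℝ ↦ (z.1, s)) (hq.continuousAt hV hx) (by fun_prop)
        have c3 : ContinuousAt q (x, t) := hq.continuousAt hV hx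
        have c4 : ContinuousAt (fun z : E × ℝ ↦ (l s).eval z.2) (x, t) := by fun_prop
        exact c4.mul ((continuousAt_const.mul (c1.inv₀ hx0)).mul (c2.mul (c3.inv₀ hx0)))
    have hev : G =ᶠ[𝓝 (x, t)] fun z ↦
        (q (x, z.2))⁻¹ • P (x, z.2) + ∑ s ∈ S, Q x s z • (G (z.1, s) - G (x, s)) := by
      filter_upwards [(hV.prod hJ).mem_nhds (show (x, t) ∈ V ×ˢ J from ⟨hx, ht⟩)] with z hz
      exact hdecomp x hx z hz
    refine ((hline.add hsum).congr_of_eventuallyEq hev).congr_fderiv ?_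
    simp only [R, Q, smul_add, Finset.smul_sum, smul_smul]
    congr 1
    · ext w
      · simp
      · simp only [ContinuousLinearMap.coe_comp, Function.comp_apply,
          ContinuousLinearMap.inr_apply, ContinuousLinearMap.smulRight_apply,
          ContinuousLinearMap.coe_snd', smul_apply, one_smul, smul_sub, smul_smul]
        rw [sub_eq_add_neg, ← neg_smul]
        congr 2 <;> field_simp
    · refine Finset.sum_congr rfl fun s _ ↦ ?_
      congr 1
      field_simp

/-- The Cramer rule for families of endomorphisms that are polynomial along lines. -/
theorem IsLinePoly.exists_det_adjugate [FiniteDimensional ℝ X] {T : Type*} [TopologicalSpace T]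
    {V : Set T} {A : T × ℝ → (X →L[ℝ] X)} (hA : IsLinePoly V A) :
    ∃ (q : T × ℝ → ℝ) (C : T × ℝ → (X →L[ℝ] X)), IsLinePoly V q ∧ IsLinePoly V C ∧
      (∀ z, q z ≠ 0 ↔ Function.Injective (A z)) ∧
      ∀ z, (A z).comp (C z) = q z • ContinuousLinearMap.id ℝ X := by
  classical
  let b := Module.finBasis ℝ X
  let M : T × ℝ → Matrix (Fin (Module.finrank ℝ X)) (Fin (Module.finrank ℝ X)) ℝ := fun z ↦
    LinearMap.toMatrix b b (A z : X →ₗ[ℝ] X)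
  have hM : ∀ i j, IsLinePoly V fun z ↦ M z i j := fun i j ↦ by
    have := hA.clm_apply ((LinearMap.toContinuousLinearMap (b.coord i)).comp
      (ContinuousLinearMap.apply ℝ X (b j)))
    refine this.congr fun x hx t ↦ ?_
    simp [M, LinearMap.toMatrix_apply]
  have hdet : ∀ N : T × ℝ → Matrix (Fin (Module.finrank ℝ X)) (Fin (Module.finrank ℝ X)) ℝ,
      (∀ i j, IsLinePoly V fun z ↦ N z i j) → IsLinePoly V fun z ↦ (N z).det := fun N hN ↦ by
    simp only [Matrix.det_apply']
    exact IsLinePoly.sum _ fun σ _ ↦ (IsLinePoly.const _).mul (IsLinePoly.prod _ fun i _ ↦ hN _ _)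
  have hadj : ∀ i j, IsLinePoly V fun z ↦ (M z).adjugate i j := fun i j ↦ by
    simp only [Matrix.adjugate_apply]
    refine hdet _ fun i' j' ↦ ?_
    simp only [Matrix.updateRow_apply]
    split_ifs
    · exact IsLinePoly.const _
    · exact hM _ _
  let L : Matrix (Fin (Module.finrank ℝ X)) (Fin (Module.finrank ℝ X)) ℝ →ₗ[ℝ] (X →L[ℝ] X) :=
    LinearMap.toContinuousLinearMap.toLinearMap ∘ₗ (Matrix.toLin b b).toLinearMap
  refine ⟨fun z ↦ (M z).det, fun z ↦ L (M z).adjugate, hdet M hM, ?_, fun z ↦ ?_, fun z ↦ ?_⟩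
  · have : ∀ z, L (M z).adjugate
        = ∑ i, ∑ j, (M z).adjugate i j • L (Matrix.single i j 1) := fun z ↦ by
      conv_lhs => rw [Matrix.matrix_eq_sum_single (M z).adjugate]
      simp [map_sum, ← map_smul, Matrix.smul_single]
    simp only [this]
    exact IsLinePoly.sum _ fun i _ ↦ IsLinePoly.sum _ fun j _ ↦
      (hadj i j).smul (IsLinePoly.const _)
  · have h1 : (M z).det = LinearMap.det (A z : X →ₗ[ℝ] X) := LinearMap.det_toMatrix b _
    change (M z).det ≠ 0 ↔ _
    rw [h1, ← isUnit_iff_ne_zero, ← LinearMap.isUnit_iff_isUnit_det,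
      LinearMap.isUnit_iff_ker_eq_bot, LinearMap.ker_eq_bot]
    rfl
  · ext w
    have h1 : (A z : X →ₗ[ℝ] X) = Matrix.toLin b b (M z) := (Matrix.toLin_toMatrix b b _).symm
    have h2 : Matrix.toLin b b (M z) (Matrix.toLin b b (M z).adjugate w) =
        Matrix.toLin b b (M z * (M z).adjugate) w := by
      rw [Matrix.toLin_mul b b b, LinearMap.comp_apply]
    rw [Matrix.mul_adjugate] at h2
    have h3 : (A z) (L (M z).adjugate w)
      = Matrix.toLin b b (M z) (Matrix.toLin b b (M z).adjugate w) := by rw [← h1]; rfl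
    simp only [ContinuousLinearMap.comp_apply, h3, h2]
    simp

end RationalAlongLines

section Bootstrap

open scoped ContDiff

variable {E : Type} [NormedAddCommGroup E] [NormedSpace ℝ E]

/-- Functions on `V × J` which are rational along the lines `{x} × J` and which, locally over
`V × J₁`, are smooth functions of `Φ`. -/
def IsRationalDescent {Y : Type} [NormedAddCommGroup Y] [NormedSpace ℝ Y] (V : Set E)
    (J J₁ : Set ℝ) (Φ : E × ℝ → E × ℝ) (G : E × ℝ → Y) : Prop :=
  (∃ (q : E × ℝ → ℝ) (P : E × ℝ → Y), IsLinePoly V q ∧ IsLinePoly V P ∧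
    ∀ z ∈ V ×ˢ J, q z ≠ 0 ∧ q z • G z = P z) ∧
  ∀ z ∈ V ×ˢ J₁, ∃ g : E × ℝ → Y, ContDiffAt ℝ ∞ g (Φ z) ∧ G =ᶠ[𝓝 z] g ∘ Φ

variable [FiniteDimensional ℝ E] {V : Set E} {J J₁ : Set ℝ} {Φ : E × ℝ → E × ℝ}
  {A : E × ℝ → (E × ℝ →L[ℝ] E × ℝ)}

/-- The derivative of a function in the class `IsRationalDescent`, taken with respect to `Φ`, is
again in the class. -/
theorem IsRationalDescent.exists_hasFDerivAt {Y : Type} [NormedAddCommGroup Y] [NormedSpace ℝ Y]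
    (hV : IsOpen V) (hJ : IsOpen J)
    (hJ₁ : J₁.Infinite) (hJ₁o : IsOpen J₁) (hJJ : J₁ ⊆ J) (hA : IsLinePoly V A)
    (hAinj : ∀ z ∈ V ×ˢ J, Function.Injective (A z))
    (hΦ : ∀ z ∈ V ×ˢ J, HasFDerivAt Φ (A z) z)
    {G : E × ℝ → Y} (hG : IsRationalDescent V J J₁ Φ G) :
    ∃ G₁ : E × ℝ → (E × ℝ →L[ℝ] Y), IsRationalDescent V J J₁ Φ G₁ ∧
      ∀ z ∈ V ×ˢ J, HasFDerivAt G ((G₁ z).comp (A z)) z := by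
  obtain ⟨⟨q, P, hq, hP, hqP⟩, hg⟩ := hG
  have hW : IsOpen (V ×ˢ J) := hV.prod hJ
  have hW₁ : IsOpen (V ×ˢ J₁) := hV.prod hJ₁o
  have hWW : V ×ˢ J₁ ⊆ V ×ˢ J := prod_mono_right hJJ
  have hΦC : ∀ z ∈ V ×ˢ J, ContDiffAt ℝ 1 Φ z := fun z hz ↦ by
    rw [contDiffAt_one_iff]
    exact ⟨A, V ×ˢ J, hW.mem_nhds hz, hA.continuousOn.mono (prod_mono_right (subset_univ _)), hΦ⟩
  have hGC : ∀ z ∈ V ×ˢ J₁, ContDiffAt ℝ 1 G z := fun z hz ↦ by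
    obtain ⟨g, hg, hGg⟩ := hg z hz
    exact ((hg.of_le (by simp)).comp z (hΦC z (hWW hz))).congr_of_eventuallyEq hGg
  obtain ⟨R, hR, hGR⟩ := exists_hasFDerivAt_of_rational hV hJ hJ₁ hJJ hq hP
    (fun z hz ↦ (hqP z hz).1) (fun z hz ↦ (hqP z hz).2)
    (fun z hz ↦ (hGC z hz).differentiableAt one_ne_zero)
    (fun z hz ↦ ((hGC z hz).fderiv_right (m := 0) (by simp)).continuousAt)
  obtain ⟨qA, C, hqA, hC, hqA0, hAC⟩ := hA.exists_det_adjugate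
  let G₁ : E × ℝ → (E × ℝ →L[ℝ] Y) := fun z ↦
    (q z * q z * qA z)⁻¹ • (R z).comp (C z)
  have hCA : ∀ z ∈ V ×ˢ J, ∀ w, C z (A z w) = qA z • w := fun z hz w ↦ by
    apply hAinj z hz
    have := congrArg (fun T : E × ℝ →L[ℝ] E × ℝ ↦ T (A z w)) (hAC z)
    simpa using this
  have hfd : ∀ z ∈ V ×ˢ J, HasFDerivAt G ((G₁ z).comp (A z)) z := fun z hz ↦ by
    refine (hGR z hz).congr_fderiv ?_
    have h1 := (hqP z hz).1
    have h2 := (hqA0 z).2 (hAinj z hz)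
    refine ContinuousLinearMap.ext fun w ↦ ?_
    simp only [G₁, ContinuousLinearMap.comp_apply, smul_apply, hCA z hz w, map_smul, smul_smul]
    congr 1
    field_simp
  refine ⟨G₁, ⟨⟨fun z ↦ q z * q z * qA z, fun z ↦ (R z).comp (C z), (hq.mul hq).mul hqA,
    IsLinePoly.bilin (ContinuousLinearMap.compL ℝ (E × ℝ) (E × ℝ) Y) hR hC, fun z hz ↦ ?_⟩,
    fun z hz ↦ ?_⟩, hfd⟩
  · have h0 : q z * q z * qA z ≠ 0 :=
      mul_ne_zero (mul_ne_zero (hqP z hz).1 (hqP z hz).1) ((hqA0 z).2 (hAinj z hz))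
    exact ⟨h0, by simp only [G₁, smul_smul, mul_inv_cancel₀ h0, one_smul]⟩
  · obtain ⟨g, hgs, hGg⟩ := hg z hz
    refine ⟨fderiv ℝ g, hgs.fderiv_right (by simp), ?_⟩
    have hgd : ∀ᶠ w in 𝓝 z, DifferentiableAt ℝ g (Φ w) := by
      have h1 : ∀ᶠ y in 𝓝 (Φ z), ContDiffAt ℝ 1 g y :=
        (hgs.of_le (m := 1) (by simp)).eventually (by simp)
      exact ((hΦC z (hWW hz)).continuousAt.eventually h1).mono
        fun w hw ↦ hw.differentiableAt one_ne_zero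
    filter_upwards [hgd, hGg.eventuallyEq_nhds, hW₁.mem_nhds hz] with w hw1 hw2 hw3
    have h1 : HasFDerivAt G ((fderiv ℝ g (Φ w)).comp (A w)) w :=
      (hw1.hasFDerivAt.comp w (hΦ w (hWW hw3))).congr_of_eventuallyEq hw2
    have h2 := (hfd w (hWW hw3)).unique h1
    have hsurj : Function.Surjective (A w) :=
      LinearMap.injective_iff_surjective (f := (A w : E × ℝ →ₗ[ℝ] E × ℝ)).1 (hAinj w (hWW hw3))
    refine ContinuousLinearMap.ext fun y ↦ ?_
    obtain ⟨x, rfl⟩ := hsurj y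
    exact congrArg (fun T : E × ℝ →L[ℝ] Y ↦ T x) h2

/-- A function in the class `IsRationalDescent` is smooth in any local chart given by `Φ`. -/
theorem IsRationalDescent.contDiffOn_comp_symm
    (hV : IsOpen V) (hJ : IsOpen J)
    (hJ₁ : J₁.Infinite) (hJ₁o : IsOpen J₁) (hJJ : J₁ ⊆ J) (hA : IsLinePoly V A)
    (hAinj : ∀ z ∈ V ×ˢ J, Function.Injective (A z))
    (hΦ : ∀ z ∈ V ×ˢ J, HasFDerivAt Φ (A z) z)
    (e : OpenPartialHomeomorph (E × ℝ) (E × ℝ)) (he : ⇑e = Φ) (hes : e.source ⊆ V ×ˢ J)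
    {Y : Type} [NormedAddCommGroup Y] [NormedSpace ℝ Y]
    {G : E × ℝ → Y} (hG : IsRationalDescent V J J₁ Φ G) :
    ContDiffOn ℝ ∞ (G ∘ e.symm) e.target := by
  rw [contDiffOn_infty]
  intro r
  induction r generalizing Y with
  | zero =>
    obtain ⟨G₁, -, hd⟩ := hG.exists_hasFDerivAt hV hJ hJ₁ hJ₁o hJJ hA hAinj hΦ
    rw [Nat.cast_zero, contDiffOn_zero]
    have : ContinuousOn G (V ×ˢ J) := fun z hz ↦ (hd z hz).continuousAt.continuousWithinAt
    exact this.comp e.continuousOn_symm fun y hy ↦ hes (e.map_target hy)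
  | succ r ih =>
    obtain ⟨G₁, hG₁, hd⟩ := hG.exists_hasFDerivAt hV hJ hJ₁ hJ₁o hJJ hA hAinj hΦ
    rw [Nat.cast_succ,
      contDiffOn_succ_iff_hasFDerivWithinAt_of_uniqueDiffOn e.open_target.uniqueDiffOn]
    refine ⟨by simp, G₁ ∘ e.symm, ih hG₁, fun y hy ↦ HasFDerivAt.hasFDerivWithinAt ?_⟩
    have hz : e.symm y ∈ V ×ˢ J := hes (e.map_target hy)
    let Ae : (E × ℝ) ≃L[ℝ] (E × ℝ) := (LinearEquiv.ofInjectiveEndo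
      (A (e.symm y) : E × ℝ →ₗ[ℝ] E × ℝ) (hAinj _ hz)).toContinuousLinearEquiv
    have hAe : (Ae : E × ℝ →L[ℝ] E × ℝ) = A (e.symm y) := by ext <;> rfl
    have hsymm := e.hasFDerivAt_symm (f' := Ae) hy (by rw [hAe, he]; exact hΦ _ hz)
    refine ((hd _ hz).comp y hsymm).congr_fderiv ?_
    rw [← hAe]
    ext <;> simp

end Bootstrap

section Submanifold

open scoped ContDiff

/-- The coordinate subspace `ℝᵏ × {0}` of `ℝⁿ`. -/
def coordSubspace (n k : ℕ) : Submodule ℝ (EuclideanSpace ℝ (Fin n)) where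
  carrier := {x | ∀ i : Fin n, k ≤ (i : ℕ) → x i = 0}
  add_mem' hx hy i hi := by simp [hx i hi, hy i hi]
  zero_mem' i _ := rfl
  smul_mem' c x hx i hi := by simp [hx i hi]

theorem finrank_coordSubspace {n k : ℕ} (hkn : k ≤ n) :
    Module.finrank ℝ (coordSubspace n k) = k := by
  let f : coordSubspace n k ≃ₗ[ℝ] (Fin k → ℝ) :=
    { toFun := fun x i ↦ x.1 (Fin.castLE hkn i)
      map_add' := fun x y ↦ rfl
      map_smul' := fun c x ↦ rfl
      invFun := fun y ↦ ⟨WithLp.toLp 2 fun i ↦ if h : (i : ℕ) < k then y ⟨i, h⟩ else 0,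
        fun i hi ↦ by simp [hi]⟩
      left_inv := fun x ↦ by
        ext i
        by_cases h : (i : ℕ) < k
        · simp [h]
        · simpa [h] using (x.2 i (not_lt.1 h)).symm
      right_inv := fun y ↦ by
        ext i
        simp }
  rw [f.finrank_eq]
  simp

/-- Two subspaces of a Euclidean space of the same dimension are exchanged by an automorphism. -/
theorem Submodule.exists_continuousLinearEquiv_mem_iff {V : Type*} [NormedAddCommGroup V]
    [InnerProductSpace ℝ V] [FiniteDimensional ℝ V] (S K : Submodule ℝ V)
    (h : Module.finrank ℝ S = Module.finrank ℝ K) : ∃ Λ : V ≃L[ℝ] V, ∀ x, Λ x ∈ K ↔ x ∈ S := by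
  let f : S ≃ₗᵢ[ℝ] K := (stdOrthonormalBasis ℝ S).equiv (stdOrthonormalBasis ℝ K) (finCongr h)
  let g : V →ₗᵢ[ℝ] V := (K.subtypeₗᵢ.comp f.toLinearIsometry).extend
  have hg (s : S) : g s = f s := LinearIsometry.extend_apply _ s
  refine ⟨(LinearEquiv.ofInjectiveEndo g.toLinearMap g.injective).toContinuousLinearEquiv,
    fun x ↦ ?_⟩
  change g x ∈ K ↔ x ∈ S
  constructor
  · intro hx
    have h1 : g x = g (f.symm ⟨g x, hx⟩) := by rw [hg]; simp
    rw [g.injective h1]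
    exact (f.symm ⟨g x, hx⟩).2
  · intro hx
    rw [show g x = f ⟨x, hx⟩ from hg ⟨x, hx⟩]
    exact (f ⟨x, hx⟩).2

variable {n k : ℕ} {X : Type*} [NormedAddCommGroup X] [NormedSpace ℝ X]

/-- A differentiable immersion into a smooth submanifold of the same dimension factors locally as a
smooth map after any linear projection that is nondegenerate along the immersion. -/
theorem IsSmoothSubmanifold.exists_contDiffAt_comp_eventuallyEq [FiniteDimensional ℝ X]
    (hkn : k ≤ n)
    (hX : Module.finrank ℝ X = k) {S : Set (EuclideanSpace ℝ (Fin n))}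
    (hS : IsSmoothSubmanifold n k S) {F : X → EuclideanSpace ℝ (Fin n)}
    {F' : X →L[ℝ] EuclideanSpace ℝ (Fin n)} {z : X} (hF : HasFDerivAt F F' z)
    (hFS : ∀ᶠ w in 𝓝 z, F w ∈ S) (L : EuclideanSpace ℝ (Fin n) →L[ℝ] X)
    (hL : Function.Injective (L.comp F')) :
    ∃ g : X → EuclideanSpace ℝ (Fin n), ContDiffAt ℝ ∞ g (L (F z)) ∧
      F =ᶠ[𝓝 z] g ∘ fun w ↦ L (F w) := by
  obtain ⟨U, φ, ψ, hU, hpU, hφU, hφ, hψ, hψφ, -, himg⟩ := hS (F z) hFS.self_of_nhds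
  let K := coordSubspace n k
  have hK : ∀ p ∈ U ∩ S, φ p ∈ K := fun p hp ↦ by
    have : φ p ∈ φ '' (U ∩ S) := mem_image_of_mem φ hp
    rw [himg] at this
    exact this.2
  let Ψ : X → K := fun w ↦ K.orthogonalProjectionOnto (φ (F w))
  have hφz : HasFDerivAt φ (fderiv ℝ φ (F z)) (F z) :=
    ((hφ.contDiffAt (hU.mem_nhds hpU)).differentiableAt (by simp)).hasFDerivAt
  have hΨ : HasFDerivAt Ψ (K.orthogonalProjectionOnto.comp ((fderiv ℝ φ (F z)).comp F')) z :=
    K.orthogonalProjectionOnto.hasFDerivAt.comp z (hφz.comp z hF)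
  have hFU : ∀ᶠ w in 𝓝 z, F w ∈ U := hF.continuousAt.eventually (hU.mem_nhds hpU)
  have hψΨ : ∀ᶠ w in 𝓝 z, ψ (Ψ w) = F w := by
    filter_upwards [hFS, hFU] with w hw hwU
    have : ((Ψ w : K) : EuclideanSpace ℝ (Fin n)) = φ (F w) :=
      K.starProjection_eq_self_iff.2 (hK _ ⟨hwU, hw⟩)
    rw [this, hψφ _ hwU]
  have hΨz : ((Ψ z : K) : EuclideanSpace ℝ (Fin n)) = φ (F z) :=
    K.starProjection_eq_self_iff.2 (hK _ ⟨hpU, hFS.self_of_nhds⟩)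
  have hψz : ContDiffAt ℝ ∞ ψ (Ψ z : K) := by
    rw [hΨz]
    exact hψ.contDiffAt (hφU.mem_nhds (mem_image_of_mem φ hpU))
  let ψK : K → EuclideanSpace ℝ (Fin n) := fun y ↦ ψ y
  have hψK : ContDiffAt ℝ ∞ ψK (Ψ z) := hψz.comp (Ψ z) K.subtypeL.contDiff.contDiffAt
  let m : K → X := fun y ↦ L (ψK y)
  have hm : ContDiffAt ℝ ∞ m (Ψ z) := L.contDiff.contDiffAt.comp (Ψ z) hψK
  have hm' : HasFDerivAt m (fderiv ℝ m (Ψ z)) (Ψ z) :=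
    (hm.differentiableAt (by simp)).hasFDerivAt
  have hmΨ : (fderiv ℝ m (Ψ z)).comp
      (K.orthogonalProjectionOnto.comp ((fderiv ℝ φ (F z)).comp F')) = L.comp F' := by
    refine (hm'.comp z hΨ).unique ((L.hasFDerivAt.comp z hF).congr_of_eventuallyEq ?_)
    filter_upwards [hψΨ] with w hw
    simp [m, ψK, hw]
  have hsurj : Function.Surjective (fderiv ℝ m (Ψ z)) := by
    have h1 : Function.Surjective (L.comp F') :=
      LinearMap.injective_iff_surjective (f := (L.comp F' : X →ₗ[ℝ] X)).1 hL
    rw [← hmΨ] at h1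
    exact Function.Surjective.of_comp h1
  have hfin : Module.finrank ℝ K = Module.finrank ℝ X := by rw [hX, finrank_coordSubspace hkn]
  have hinj : Function.Injective (fderiv ℝ m (Ψ z)) :=
    (LinearMap.injective_iff_surjective_of_finrank_eq_finrank
      (f := (fderiv ℝ m (Ψ z) : K →ₗ[ℝ] X)) hfin).2 hsurj
  let M : K ≃L[ℝ] X :=
    (LinearEquiv.ofBijective (fderiv ℝ m (Ψ z) : K →ₗ[ℝ] X) ⟨hinj, hsurj⟩).toContinuousLinearEquiv
  have hM : HasFDerivAt m (M : K →L[ℝ] X) (Ψ z) := hm'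
  let e := hm.toOpenPartialHomeomorph m hM (by simp)
  have hez : Ψ z ∈ e.source := hm.mem_toOpenPartialHomeomorph_source hM (by simp)
  have hmz : m (Ψ z) = L (F z) := by simp only [m, ψK]; rw [hψΨ.self_of_nhds]
  have hθ : ContDiffAt ℝ ∞ e.symm (m (Ψ z)) := hm.to_localInverse hM (by simp)
  have hθz : e.symm (m (Ψ z)) = Ψ z := e.left_inv hez
  refine ⟨fun y ↦ ψK (e.symm y), ?_, ?_⟩
  · rw [← hmz]
    exact ContDiffAt.comp (g := ψK) (f := e.symm) (m (Ψ z)) (by rw [hθz]; exact hψK) hθ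
  · filter_upwards [hψΨ, hΨ.continuousAt.eventually (e.open_source.mem_nhds hez)] with w hw hwe
    have h1 : e.symm (m (Ψ w)) = Ψ w := e.left_inv hwe
    have h2 : m (Ψ w) = L (F w) := by simp only [m, ψK]; rw [hw]
    change F w = ψK (e.symm (L (F w)))
    rw [← h2, h1]
    exact hw.symm

/-- An embedded patch which is locally the graph of a smooth map over its projection by `L` is
straightened by a smooth diffeomorphism. -/
theorem exists_straightening (hkn : k ≤ n) (hX : Module.finrank ℝ X = k)
    {F : X → EuclideanSpace ℝ (Fin n)} {W : Set X}
    (hemb : Topology.IsEmbedding fun q : W ↦ F q)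
    (L : EuclideanSpace ℝ (Fin n) →L[ℝ] X) (R : X →L[ℝ] EuclideanSpace ℝ (Fin n))
    (hLR : ∀ y, L (R y) = y) (e : OpenPartialHomeomorph X X) (he : ∀ z, e z = L (F z))
    (heW : e.source ⊆ W) (hu : ContDiffOn ℝ ∞ (F ∘ e.symm) e.target) {z : X} (hz : z ∈ e.source) :
    ∃ U : Set (EuclideanSpace ℝ (Fin n)),
      ∃ φ ψ : EuclideanSpace ℝ (Fin n) → EuclideanSpace ℝ (Fin n),
        IsOpen U ∧ F z ∈ U ∧ IsOpen (φ '' U) ∧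
        ContDiffOn ℝ (⊤ : ℕ∞) φ U ∧ ContDiffOn ℝ (⊤ : ℕ∞) ψ (φ '' U) ∧
        (∀ x ∈ U, ψ (φ x) = x) ∧ (∀ y ∈ φ '' U, φ (ψ y) = y) ∧
        φ '' (U ∩ F '' W) = (φ '' U) ∩ {x | ∀ i : Fin n, k ≤ (i : ℕ) → x i = 0} := by
  obtain ⟨U₀, hU₀, hU₀e⟩ := hemb.isInducing.isOpen_iff.1
    (e.open_source.preimage (continuous_subtype_val (p := fun x ↦ x ∈ W)))
  have hmem : ∀ w ∈ W, F w ∈ U₀ ↔ w ∈ e.source := fun w hw ↦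
    Set.ext_iff.1 hU₀e ⟨w, hw⟩
  have hRinj : Function.Injective R := Function.LeftInverse.injective hLR
  obtain ⟨Λ, hΛ⟩ := Submodule.exists_continuousLinearEquiv_mem_iff
    (R : X →ₗ[ℝ] EuclideanSpace ℝ (Fin n)).range (coordSubspace n k) (by
      rw [LinearMap.finrank_range_of_inj hRinj, hX, finrank_coordSubspace hkn])
  let u : X → EuclideanSpace ℝ (Fin n) := F ∘ e.symm
  have hLu : ∀ y ∈ e.target, L (u y) = y := fun y hy ↦ by
    simp only [u, Function.comp_apply]
    rw [← he, e.right_inv hy]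
  let φ : EuclideanSpace ℝ (Fin n) → EuclideanSpace ℝ (Fin n) :=
    fun p ↦ Λ (p - u (L p) + R (L p))
  let ψ : EuclideanSpace ℝ (Fin n) → EuclideanSpace ℝ (Fin n) :=
    fun y ↦ Λ.symm y + u (L (Λ.symm y)) - R (L (Λ.symm y))
  let U := U₀ ∩ L ⁻¹' e.target
  let D := (fun y ↦ L (Λ.symm y)) ⁻¹' e.target
  have hLφ : ∀ p, L p ∈ e.target → L (Λ.symm (φ p)) = L p := fun p hp ↦ by
    simp [φ, hLu _ hp, hLR]
  have hLψ : ∀ y ∈ D, L (ψ y) = L (Λ.symm y) := fun y hy ↦ by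
    simp [ψ, hLu _ hy, hLR]
  have hψφ : ∀ p, L p ∈ e.target → ψ (φ p) = p := fun p hp ↦ by
    simp only [ψ, hLφ p hp]
    simp [φ]
    abel
  have hφψ : ∀ y ∈ D, φ (ψ y) = y := fun y hy ↦ by
    simp only [φ, hLψ y hy]
    simp [ψ]
    abel
  have hD : IsOpen D := e.open_target.preimage (L.continuous.comp Λ.symm.continuous)
  have hφC : ContDiffOn ℝ ∞ φ (L ⁻¹' e.target) :=
    Λ.contDiff.comp_contDiffOn ((contDiffOn_id.sub
      (hu.comp L.contDiff.contDiffOn fun p hp ↦ hp)).add (R.contDiff.comp L.contDiff).contDiffOn)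
  have hψC : ContDiffOn ℝ ∞ ψ D := by
    have h1 : ContDiff ℝ ∞ fun y ↦ L (Λ.symm y) := L.contDiff.comp Λ.symm.contDiff
    exact (Λ.symm.contDiff.contDiffOn.add (hu.comp h1.contDiffOn fun p hp ↦ hp)).sub
      (R.contDiff.comp h1).contDiffOn
  have hφU : φ '' U = D ∩ ψ ⁻¹' U₀ := by
    ext y
    constructor
    · rintro ⟨p, ⟨hp1, hp2⟩, rfl⟩
      refine ⟨?_, ?_⟩
      · change L (Λ.symm (φ p)) ∈ e.target
        rw [hLφ p hp2]
        exact hp2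
      · rwa [mem_preimage, hψφ p hp2]
    · rintro ⟨h1, h2⟩
      exact ⟨ψ y, ⟨h2, by rw [mem_preimage, hLψ y h1]; exact h1⟩, hφψ y h1⟩
  refine ⟨U, φ, ψ, hU₀.inter (e.open_target.preimage L.continuous), ⟨?_, ?_⟩, ?_,
    hφC.mono inter_subset_right, hψC.mono ?_, fun p hp ↦ hψφ p hp.2, fun y hy ↦ ?_, ?_⟩
  · exact (hmem z (heW hz)).2 hz
  · rw [mem_preimage, ← he]
    exact e.map_source hz
  · rw [hφU]
    exact hψC.continuousOn.isOpen_inter_preimage hD hU₀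
  · rw [hφU]
    exact inter_subset_left
  · rw [hφU] at hy
    exact hφψ y hy.1
  · have key : ∀ p ∈ U, p ∈ F '' W ↔ φ p ∈ coordSubspace n k := fun p hp ↦ by
      rw [hΛ, LinearMap.mem_range]
      constructor
      · rintro ⟨w, hw, rfl⟩
        have hws := (hmem w hw).1 hp.1
        have h1 : u (L (F w)) = F w := by
          rw [← he]
          exact congrArg F (e.left_inv hws)
        exact ⟨L (F w), by simp [h1]⟩
      · rintro ⟨y, hy⟩
        have h1 : L (R y) = L (p - u (L p) + R (L p)) := congrArg L hy
        have h2 : y = L p := by simpa [hLR, hLu _ hp.2] using h1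
        have h3 : p = u (L p) := by
          rw [h2] at hy
          simpa [sub_eq_zero] using hy.symm
        exact ⟨e.symm (L p), heW (e.map_target hp.2), h3.symm⟩
    ext y
    constructor
    · rintro ⟨p, ⟨hp1, hp2⟩, rfl⟩
      exact ⟨⟨p, hp1, rfl⟩, (key p hp1).1 hp2⟩
    · rintro ⟨⟨p, hp1, rfl⟩, hp2⟩
      exact ⟨p, ⟨hp1, (key p hp1).2 hp2⟩, rfl⟩

end Submanifold

/-- Smooth extension for ruled submanifolds: if the `C^{1,1}` ruled set
`Σ = F(B × (c,d))`, `F(x,t) = h(x) + t • v(x)` with `‖v(x)‖ = 1`, is an embedded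
`k`-dimensional submanifold (`F` an immersion and a homeomorphism onto its image)
and the slab `F(B × (ε₁,ε₂))` is a `C^∞` embedded `k`-submanifold of `ℝⁿ`, then
the whole ruled set `Σ` is a `C^∞` embedded `k`-submanifold of `ℝⁿ`. -/
theorem ruled_submanifold_smooth_extension (k n : ℕ) (hk : 1 ≤ k)
    (B : Set (EuclideanSpace ℝ (Fin (k - 1)))) (hB : IsOpen B)
    (c d : ℝ) (hcd : c < d)
    (h v : EuclideanSpace ℝ (Fin (k - 1)) → EuclideanSpace ℝ (Fin n))
    (h' v' : EuclideanSpace ℝ (Fin (k - 1)) →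
      (EuclideanSpace ℝ (Fin (k - 1)) →L[ℝ] EuclideanSpace ℝ (Fin n)))
    (hh : ∀ x ∈ B, HasFDerivAt h (h' x) x)
    (hv : ∀ x ∈ B, HasFDerivAt v (v' x) x)
    (hh'lip : ∀ x ∈ B, ∃ t ∈ nhdsWithin x B, ∃ K : NNReal, LipschitzOnWith K h' t)
    (hv'lip : ∀ x ∈ B, ∃ t ∈ nhdsWithin x B, ∃ K : NNReal, LipschitzOnWith K v' t)
    (hunit : ∀ x ∈ B, ‖v x‖ = 1)
    (F : EuclideanSpace ℝ (Fin (k - 1)) × ℝ → EuclideanSpace ℝ (Fin n))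
    (hF : ∀ p, F p = h p.1 + p.2 • v p.1)
    (himm : ∀ p ∈ B ×ˢ Ioo c d, Function.Injective (fderiv ℝ F p))
    (hemb : Topology.IsEmbedding (fun q : (B ×ˢ Ioo c d :
      Set (EuclideanSpace ℝ (Fin (k - 1)) × ℝ)) => F q))
    (ε₁ ε₂ : ℝ) (hcε₁ : c ≤ ε₁) (hε₁ε₂ : ε₁ < ε₂) (hε₂d : ε₂ ≤ d)
    (hsmooth : IsSmoothSubmanifold n k (F '' (B ×ˢ Ioo ε₁ ε₂))) :
    IsSmoothSubmanifold n k (F '' (B ×ˢ Ioo c d)) := by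
  intro p hp
  obtain ⟨⟨x₀, t₀⟩, ⟨hx₀, ht₀⟩, rfl⟩ := hp
  have hX : Module.finrank ℝ (EuclideanSpace ℝ (Fin (k - 1)) × ℝ) = k := by
    simp [Module.finrank_prod]
    omega
  have hcontOn : ∀ {f : EuclideanSpace ℝ (Fin (k - 1)) →
      (EuclideanSpace ℝ (Fin (k - 1)) →L[ℝ] EuclideanSpace ℝ (Fin n))},
      (∀ x ∈ B, ∃ t ∈ nhdsWithin x B, ∃ K : NNReal, LipschitzOnWith K f t) → ContinuousOn f B := by
    intro f hf x hx
    obtain ⟨t, ht, K, hK⟩ := hf x hx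
    exact (hK.continuousOn x (mem_of_mem_nhdsWithin hx ht)).mono_of_mem_nhdsWithin ht
  have hvC : ContinuousOn v B := fun x hx ↦ (hv x hx).continuousAt.continuousWithinAt
  have hhC : ContinuousOn h B := fun x hx ↦ (hh x hx).continuousAt.continuousWithinAt
  have hFeq : F = fun p ↦ h p.1 + p.2 • v p.1 := funext hF
  let fst := ContinuousLinearMap.fst ℝ (EuclideanSpace ℝ (Fin (k - 1))) ℝ
  let snd := ContinuousLinearMap.snd ℝ (EuclideanSpace ℝ (Fin (k - 1))) ℝ
  let F' : EuclideanSpace ℝ (Fin (k - 1)) × ℝ →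
      (EuclideanSpace ℝ (Fin (k - 1)) × ℝ →L[ℝ] EuclideanSpace ℝ (Fin n)) :=
    fun z ↦ (h' z.1).comp fst + (z.2 • (v' z.1).comp fst + snd.smulRight (v z.1))
  have hF' : ∀ z, z.1 ∈ B → HasFDerivAt F (F' z) z := fun z hz ↦ by
    rw [hFeq]
    exact ((hh _ hz).comp z hasFDerivAt_fst).add
      (HasFDerivAt.smul hasFDerivAt_snd ((hv _ hz).comp z hasFDerivAt_fst))
  have hline : ∀ {Y : Type} [NormedAddCommGroup Y] [NormedSpace ℝ Y]
      {a : EuclideanSpace ℝ (Fin (k - 1)) → Y}, ContinuousOn a B →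
      IsLinePoly B fun z ↦ z.2 • a z.1 := fun {_ _ _ a} ha ↦ by
    simpa using IsLinePoly.eval_smul X ha
  have hFpoly : IsLinePoly B F := by
    rw [hFeq]
    exact (IsLinePoly.of_continuousOn hhC).add (hline hvC)
  have hF'poly : IsLinePoly B F' :=
    (IsLinePoly.of_continuousOn ((hcontOn hh'lip).clm_comp continuousOn_const)).add
      ((hline ((hcontOn hv'lip).clm_comp continuousOn_const)).add
        ((IsLinePoly.of_continuousOn hvC).clm_apply
          (ContinuousLinearMap.smulRightL ℝ _ (EuclideanSpace ℝ (Fin n)) snd)))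
  let F₀ : EuclideanSpace ℝ (Fin (k - 1)) × ℝ →ₗ[ℝ] EuclideanSpace ℝ (Fin n) := F' (x₀, t₀)
  have hinj₀ : Function.Injective F₀ := by
    change Function.Injective (F' (x₀, t₀))
    rw [← (hF' (x₀, t₀) hx₀).fderiv]
    exact himm _ ⟨hx₀, ht₀⟩
  have hkn : k ≤ n := by
    have := LinearMap.finrank_le_finrank_of_injective (f := F₀) hinj₀
    rwa [hX, finrank_euclideanSpace_fin] at this
  obtain ⟨L₀, hL₀⟩ := F₀.exists_leftInverse_of_injective (LinearMap.ker_eq_bot.2 hinj₀)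
  let L : EuclideanSpace ℝ (Fin n) →L[ℝ] EuclideanSpace ℝ (Fin (k - 1)) × ℝ :=
    LinearMap.toContinuousLinearMap L₀
  have hLR : ∀ y, L (F' (x₀, t₀) y) = y := fun y ↦ LinearMap.congr_fun hL₀ y
  let Φ : EuclideanSpace ℝ (Fin (k - 1)) × ℝ → EuclideanSpace ℝ (Fin (k - 1)) × ℝ :=
    fun z ↦ L (F z)
  let A : EuclideanSpace ℝ (Fin (k - 1)) × ℝ →
      (EuclideanSpace ℝ (Fin (k - 1)) × ℝ →L[ℝ] EuclideanSpace ℝ (Fin (k - 1)) × ℝ) :=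
    fun z ↦ L.comp (F' z)
  have hA : IsLinePoly B A := hF'poly.clm_apply (ContinuousLinearMap.compL ℝ _ _ _ L)
  have hΦ : ∀ z, z.1 ∈ B → HasFDerivAt Φ (A z) z := fun z hz ↦
    L.hasFDerivAt.comp z (hF' z hz)
  obtain ⟨q, -, hq, -, hqA, -⟩ := hA.exists_det_adjugate
  have hq₀ : q (x₀, t₀) ≠ 0 := (hqA _).2 (Function.LeftInverse.injective (g := id) hLR)
  obtain ⟨s₀, hs₀, hqs₀⟩ := hq.exists_ne_zero hx₀ hq₀ (Ioo_infinite hε₁ε₂)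
  have hbox : ∀ t, q (x₀, t) ≠ 0 → ∃ V, IsOpen V ∧ x₀ ∈ V ∧ ∃ J : Set ℝ, IsOpen J ∧ t ∈ J ∧
      ∀ z ∈ V ×ˢ J, q z ≠ 0 := fun t ht ↦ by
    obtain ⟨V, J, hV, hx, hJ, htJ, hVJ⟩ := mem_nhds_prod_iff'.1
      ((hq.continuousAt hB (z := (x₀, t)) hx₀).eventually_ne ht)
    exact ⟨V, hV, hx, J, hJ, htJ, fun z hz ↦ hVJ hz⟩
  obtain ⟨V₁, hV₁, hxV₁, J₁, hJ₁, hsJ₁, hq₁⟩ := hbox s₀ hqs₀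
  obtain ⟨V₂, hV₂, hxV₂, J₂, hJ₂, htJ₂, hq₂⟩ := hbox t₀ hq₀
  let V := B ∩ (V₁ ∩ V₂)
  let I₁ := J₁ ∩ Ioo ε₁ ε₂
  let J := I₁ ∪ (J₂ ∩ Ioo c d)
  have hV : IsOpen V := hB.inter (hV₁.inter hV₂)
  have hI₁ : IsOpen I₁ := hJ₁.inter isOpen_Ioo
  have hJ : IsOpen J := hI₁.union (hJ₂.inter isOpen_Ioo)
  have hI₁inf : I₁.Infinite := infinite_of_mem_nhds s₀ (hI₁.mem_nhds ⟨hsJ₁, hs₀⟩)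
  have hVB : V ⊆ B := inter_subset_left
  have hJcd : J ⊆ Ioo c d :=
    union_subset (inter_subset_right.trans (Ioo_subset_Ioo hcε₁ hε₂d)) inter_subset_right
  have hAinj : ∀ z ∈ V ×ˢ J, Function.Injective (A z) := by
    rintro z ⟨⟨-, h1, h2⟩, ht | ht⟩
    · exact (hqA z).1 (hq₁ z ⟨h1, ht.1⟩)
    · exact (hqA z).1 (hq₂ z ⟨h2, ht.1⟩)
  have hdesc : IsRationalDescent V J I₁ Φ F := by
    refine ⟨⟨fun _ ↦ 1, F, IsLinePoly.const 1, hFpoly.mono hVB, fun z _ ↦ by simp⟩, fun z hz ↦ ?_⟩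
    refine hsmooth.exists_contDiffAt_comp_eventuallyEq hkn hX (hF' z (hVB hz.1)) ?_ L
      (hAinj z ⟨hz.1, Or.inl hz.2⟩)
    filter_upwards [(hB.prod isOpen_Ioo).mem_nhds
      (show z ∈ B ×ˢ Ioo ε₁ ε₂ from ⟨hVB hz.1, hz.2.2⟩)] with w hw
    exact mem_image_of_mem F hw
  have hz₀ : (x₀, t₀) ∈ V ×ˢ J := ⟨⟨hx₀, hxV₁, hxV₂⟩, Or.inr ⟨htJ₂, ht₀⟩⟩
  have hA' : IsLinePoly V A := hA.mono hVB
  have hΦC : ContDiffAt ℝ 1 Φ (x₀, t₀) := by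
    rw [contDiffAt_one_iff]
    exact ⟨A, V ×ˢ J, (hV.prod hJ).mem_nhds hz₀,
      hA'.continuousOn.mono (prod_mono_right (subset_univ _)), fun z hz ↦ hΦ z (hVB hz.1)⟩
  have hA₀ : HasFDerivAt Φ ((ContinuousLinearEquiv.refl ℝ
      (EuclideanSpace ℝ (Fin (k - 1)) × ℝ) : _ →L[ℝ] _)) (x₀, t₀) :=
    (hΦ _ hx₀).congr_fderiv (ContinuousLinearMap.ext hLR)
  let e := (hΦC.toOpenPartialHomeomorph Φ hA₀ one_ne_zero).restrOpen (V ×ˢ J) (hV.prod hJ)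
  have hez : (x₀, t₀) ∈ e.source :=
    ⟨hΦC.mem_toOpenPartialHomeomorph_source hA₀ one_ne_zero, hz₀⟩
  have hes : e.source ⊆ V ×ˢ J := fun z hz ↦ hz.2
  exact exists_straightening hkn hX hemb L (F' (x₀, t₀)) hLR e (fun _ ↦ rfl)
    (hes.trans (prod_mono hVB hJcd))
    (hdesc.contDiffOn_comp_symm hV hJ hI₁inf hI₁ subset_union_left hA' hAinj
      (fun z hz ↦ hΦ z (hVB hz.1)) e rfl hes) hez
end

section
/- Let Ω ⊆ ℝⁿ be a nonempty closed convex set, let P_Ω denote the metric projection onto Ω, and let δ > 0. Then the unit outward normal field u(x) = (x − P_Ω(x)) / dist(x, Ω) is Lipschitz continuous on the set { x ∈ ℝⁿ : dist(x, Ω) ≥ δ }; that is, there exists L ≥ 0 such that ‖u(x) − u(y)‖ ≤ L·‖x − y‖ for all x, y with dist(x, Ω) ≥ δ and dist(y, Ω) ≥ δ. Consequently the distance function dist(·, Ω) is C¹ with Lipschitz gradient on this set. -/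
open Metric Set

open scoped RealInnerProductSpace

section MetricProjection

variable {E : Type*} [NormedAddCommGroup E] [InnerProductSpace ℝ E] {Ω : Set E}

/-- The variational inequality for a nearest point `p` of a convex set. -/
theorem Convex.inner_sub_nearest_le_zero (hconv : Convex ℝ Ω) {x p z : E} (hp : p ∈ Ω)
    (hxp : dist x p = infDist x Ω) (hz : z ∈ Ω) : ⟪x - p, z - p⟫ ≤ 0 := by
  refine (norm_eq_iInf_iff_real_inner_le_zero hconv hp).1 ?_ z hz
  rw [← dist_eq_norm, hxp, infDist_eq_iInf]
  simp only [dist_eq_norm]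

/-- The displacement from nearest points of a convex set is nonexpansive. -/
theorem Convex.norm_sub_nearest_sub_le (hconv : Convex ℝ Ω) {x y p q : E} (hp : p ∈ Ω)
    (hxp : dist x p = infDist x Ω) (hq : q ∈ Ω) (hyq : dist y q = infDist y Ω) :
    ‖(x - p) - (y - q)‖ ≤ ‖x - y‖ := by
  have h₁ := hconv.inner_sub_nearest_le_zero hp hxp hq
  have h₂ := hconv.inner_sub_nearest_le_zero hq hyq hp
  have hexp : ‖x - y‖ ^ 2 = ‖(x - p) - (y - q)‖ ^ 2
      + 2 * ⟪(x - p) - (y - q), p - q⟫ + ‖p - q‖ ^ 2 := by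
    rw [← norm_add_sq_real]
    congr 2
    abel
  have hinner : ⟪(x - p) - (y - q), p - q⟫ = -⟪x - p, q - p⟫ - ⟪y - q, p - q⟫ := by
    rw [inner_sub_left, ← inner_neg_right, neg_sub]
  refine (sq_le_sq₀ (by positivity) (norm_nonneg _)).1 ?_
  nlinarith [sq_nonneg ‖p - q‖]

/-- Radial projection is `δ⁻¹`-Lipschitz outside the open ball of radius `δ`. -/
theorem norm_inv_norm_smul_sub_le {δ : ℝ} (hδ : 0 < δ) {a b : E} (ha : δ ≤ ‖a‖) (hb : δ ≤ ‖b‖) :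
    ‖‖a‖⁻¹ • a - ‖b‖⁻¹ • b‖ ≤ δ⁻¹ * ‖a - b‖ := by
  have ha' : 0 < ‖a‖ := hδ.trans_le ha
  have hb' : 0 < ‖b‖ := hδ.trans_le hb
  have hsq : ‖‖a‖⁻¹ • a - ‖b‖⁻¹ • b‖ ^ 2 * (‖a‖ * ‖b‖) = ‖a - b‖ ^ 2 - (‖a‖ - ‖b‖) ^ 2 := by
    rw [norm_sub_sq_real, norm_sub_sq_real, norm_smul, norm_smul, real_inner_smul_left,
      real_inner_smul_right, norm_inv, norm_inv, norm_norm, norm_norm]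
    field_simp
    ring
  have hmul : δ ^ 2 ≤ ‖a‖ * ‖b‖ := by nlinarith
  rw [le_inv_mul_iff₀ hδ]
  refine (sq_le_sq₀ (by positivity) (norm_nonneg _)).1 ?_
  rw [mul_pow]
  nlinarith [mul_le_mul_of_nonneg_left hmul (sq_nonneg ‖‖a‖⁻¹ • a - ‖b‖⁻¹ • b‖),
    sq_nonneg (‖a‖ - ‖b‖)]

/-- The affine function supporting `Ω` at a nearest point minorizes the distance to `Ω`. -/
theorem Convex.infDist_add_inner_le (hconv : Convex ℝ Ω) {x y p : E} (hp : p ∈ Ω)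
    (hxp : dist x p = infDist x Ω) (hpos : 0 < infDist x Ω) :
    infDist x Ω + ⟪(infDist x Ω)⁻¹ • (x - p), y - x⟫ ≤ infDist y Ω := by
  have hnorm : ‖x - p‖ = infDist x Ω := by rw [← dist_eq_norm, hxp]
  refine (le_infDist ⟨p, hp⟩).2 fun z hz => ?_
  have hz' := hconv.inner_sub_nearest_le_zero hp hxp hz
  have hcs := real_inner_le_norm (x - p) (y - z)
  have hsplit : ⟪x - p, y - x⟫ = ⟪x - p, y - z⟫ + ⟪x - p, z - p⟫ - infDist x Ω ^ 2 := by
    rw [← hnorm, ← real_inner_self_eq_norm_sq, ← inner_add_right, ← inner_sub_right]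
    congr 1
    abel
  rw [real_inner_smul_left, dist_eq_norm, ← mul_le_mul_iff_right₀ hpos, mul_add,
    mul_inv_cancel_left₀ hpos.ne']
  rw [hnorm] at hcs
  nlinarith

/-- A quadratic upper bound for the distance to `Ω` in terms of a nearest point. -/
theorem infDist_le_add_inner_add_sq {x y p : E} (hp : p ∈ Ω)
    (hxp : dist x p = infDist x Ω) (hpos : 0 < infDist x Ω) :
    infDist y Ω ≤ infDist x Ω + ⟪(infDist x Ω)⁻¹ • (x - p), y - x⟫
      + (2 * infDist x Ω)⁻¹ * ‖y - x‖ ^ 2 := by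
  have hnorm : ‖x - p‖ = infDist x Ω := by rw [← dist_eq_norm, hxp]
  have hle : infDist y Ω ≤ ‖y - p‖ := dist_eq_norm y p ▸ infDist_le_dist_of_mem hp
  have hexp : ‖y - p‖ ^ 2 = infDist x Ω ^ 2 + 2 * ⟪x - p, y - x⟫ + ‖y - x‖ ^ 2 := by
    rw [← hnorm, ← norm_add_sq_real]
    congr 2
    abel
  rw [real_inner_smul_left, ← mul_le_mul_iff_right₀ (mul_pos two_pos hpos)]
  have hrhs : 2 * infDist x Ω * (infDist x Ω + (infDist x Ω)⁻¹ * ⟪x - p, y - x⟫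
      + (2 * infDist x Ω)⁻¹ * ‖y - x‖ ^ 2) = infDist x Ω ^ 2 + ‖y - p‖ ^ 2 := by
    rw [hexp]
    field_simp
    ring
  rw [hrhs]
  nlinarith [sq_nonneg (infDist x Ω - ‖y - p‖)]

/-- The distance to a convex set has the unit outward normal as its gradient off the set. -/
theorem Convex.hasGradientAt_infDist [CompleteSpace E] (hconv : Convex ℝ Ω) {x p : E}
    (hp : p ∈ Ω) (hxp : dist x p = infDist x Ω) (hpos : 0 < infDist x Ω) :
    HasGradientAt (fun y => infDist y Ω) ((infDist x Ω)⁻¹ • (x - p)) x := by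
  rw [hasGradientAt_iff_isLittleO]
  refine Asymptotics.IsBigO.trans_isLittleO (g := fun y => ‖y - x‖ ^ 2) ?_ ?_
  · refine Asymptotics.IsBigO.of_bound (2 * infDist x Ω)⁻¹ (Filter.Eventually.of_forall fun y => ?_)
    have hlow := hconv.infDist_add_inner_le (y := y) hp hxp hpos
    have hupp := infDist_le_add_inner_add_sq (y := y) hp hxp hpos
    rw [Real.norm_of_nonneg (by linarith), Real.norm_of_nonneg (by positivity)]
    linarith
  · exact Asymptotics.isLittleO_pow_sub_sub x one_lt_two

end MetricProjection

/-- For a nonempty closed convex set `Ω ⊆ ℝⁿ` with metric projection `P` and `δ > 0`,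
the unit outward normal field `u x = (x - P x) / dist(x, Ω)` is Lipschitz on
`{x : dist(x, Ω) ≥ δ}`; consequently the distance function is `C¹` with Lipschitz
gradient there (its gradient at each point of this set being `u x`). -/
theorem unit_normal_lipschitz (n : ℕ) (Ω : Set (EuclideanSpace ℝ (Fin n)))
    (hne : Ω.Nonempty) (hcl : IsClosed Ω) (hconv : Convex ℝ Ω)
    (P : EuclideanSpace ℝ (Fin n) → EuclideanSpace ℝ (Fin n))
    (hP : ∀ x, P x ∈ Ω ∧ dist x (P x) = Metric.infDist x Ω)
    (δ : ℝ) (hδ : 0 < δ)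
    (u : EuclideanSpace ℝ (Fin n) → EuclideanSpace ℝ (Fin n))
    (hu : ∀ x, u x = (Metric.infDist x Ω)⁻¹ • (x - P x)) :
    (∃ L : ℝ, 0 ≤ L ∧ ∀ x ∈ {z | δ ≤ Metric.infDist z Ω},
        ∀ y ∈ {z | δ ≤ Metric.infDist z Ω}, ‖u x - u y‖ ≤ L * ‖x - y‖) ∧
      ∀ x ∈ {z | δ ≤ Metric.infDist z Ω},
        HasGradientAt (fun y => Metric.infDist y Ω) (u x) x := by
  have hnorm : ∀ x, ‖x - P x‖ = infDist x Ω := fun x => by rw [← dist_eq_norm, (hP x).2]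
  refine ⟨⟨δ⁻¹, inv_nonneg.2 hδ.le, fun x hx y hy => ?_⟩, fun x hx => ?_⟩
  · rw [mem_ofPred_eq, ← hnorm] at hx hy
    rw [hu, hu, ← hnorm, ← hnorm]
    exact (norm_inv_norm_smul_sub_le hδ hx hy).trans <| mul_le_mul_of_nonneg_left
      (hconv.norm_sub_nearest_sub_le (hP x).1 (hP x).2 (hP y).1 (hP y).2) (inv_nonneg.2 hδ.le)
  · rw [hu]
    exact hconv.hasGradientAt_infDist (hP x).1 (hP x).2 (hδ.trans_le hx)
end

section
/- Let Ω ⊆ ℝⁿ be a nonempty closed convex set, let δ > 0, and for each z with dist(z, Ω) > 0 write u(z) = (z − P_Ω(z))/dist(z, Ω) for the unit outward normal at z. Suppose x and y satisfy dist(x, Ω) = dist(y, Ω) = δ, and suppose s, t ∈ (−δ, ∞) are such that x + s·u(x) = y + t·u(y). Then x = y and s = t. In other words, the normal exponential map (x, t) ↦ x + t·u(x) from { z : dist(z, Ω) = δ } × (−δ, ∞) into ℝⁿ is injective. -/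
open Metric Set

/-- The variational inequality characterizing a nearest point of a convex set. -/
lemma inner_sub_sub_nonpos_of_dist_eq_infDist {E : Type*} [NormedAddCommGroup E]
    [InnerProductSpace ℝ E] {K : Set E} (hK : Convex ℝ K) {x p q : E} (hp : p ∈ K) (hq : q ∈ K)
    (h : dist x p = Metric.infDist x K) : inner ℝ (x - p) (q - p) ≤ 0 := by
  refine (norm_eq_iInf_iff_real_inner_le_zero hK hp).1 ?_ q hq
  simpa only [Metric.infDist_eq_iInf, dist_eq_norm] using h

/-- Normal rays of a convex set issued from `p` and `q` can only meet if `p = q`. -/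
lemma eq_of_add_smul_eq_add_smul_of_inner_nonpos {E : Type*} [NormedAddCommGroup E]
    [InnerProductSpace ℝ E] {p q a b : E} {c d : ℝ} (hc : 0 ≤ c) (hd : 0 ≤ d)
    (ha : inner ℝ a (q - p) ≤ 0) (hb : inner ℝ b (p - q) ≤ 0)
    (h : p + c • a = q + d • b) : p = q := by
  have hw : q - p = c • a - d • b := by
    rw [sub_eq_sub_iff_add_eq_add, ← h, add_comm]
  have hsq : inner ℝ (q - p) (q - p) = c * inner ℝ a (q - p) + d * inner ℝ b (p - q) := by
    rw [← neg_sub q p, inner_neg_right]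
    nth_rewrite 1 [hw]
    rw [inner_sub_left, real_inner_smul_left, real_inner_smul_left]
    ring
  have hle : inner ℝ (q - p) (q - p) ≤ 0 := by
    rw [hsq]
    exact add_nonpos (mul_nonpos_of_nonneg_of_nonpos hc ha) (mul_nonpos_of_nonneg_of_nonpos hd hb)
  exact (sub_eq_zero.1 (real_inner_self_nonpos.1 hle)).symm

/-- For a nonempty closed convex set `Ω ⊆ ℝⁿ` with metric projection `P` and `δ > 0`,
the normal exponential map `(x, t) ↦ x + t • u x` from the equidistant hypersurface
`{z : dist(z, Ω) = δ}` times `(-δ, ∞)` is injective, where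
`u z = (z - P z)/dist(z, Ω)` is the unit outward normal. -/
theorem normal_exponential_injective (n : ℕ) (Ω : Set (EuclideanSpace ℝ (Fin n)))
    (hne : Ω.Nonempty) (hcl : IsClosed Ω) (hconv : Convex ℝ Ω)
    (P : EuclideanSpace ℝ (Fin n) → EuclideanSpace ℝ (Fin n))
    (hP : ∀ x, P x ∈ Ω ∧ dist x (P x) = Metric.infDist x Ω)
    (δ : ℝ) (hδ : 0 < δ)
    (u : EuclideanSpace ℝ (Fin n) → EuclideanSpace ℝ (Fin n))
    (hu : ∀ z, 0 < Metric.infDist z Ω → u z = (Metric.infDist z Ω)⁻¹ • (z - P z))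
    (x y : EuclideanSpace ℝ (Fin n))
    (hx : Metric.infDist x Ω = δ) (hy : Metric.infDist y Ω = δ)
    (s t : ℝ) (hs : -δ < s) (ht : -δ < t)
    (heq : x + s • u x = y + t • u y) :
    x = y ∧ s = t := by
  obtain ⟨hpx, hdx⟩ := hP x
  obtain ⟨hpy, hdy⟩ := hP y
  have hc : 0 < 1 + s * δ⁻¹ := by
    have : 1 + s * δ⁻¹ = (δ + s) * δ⁻¹ := by field_simp
    rw [this]
    exact mul_pos (by linarith) (inv_pos.2 hδ)
  have hd : 0 < 1 + t * δ⁻¹ := by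
    have : 1 + t * δ⁻¹ = (δ + t) * δ⁻¹ := by field_simp
    rw [this]
    exact mul_pos (by linarith) (inv_pos.2 hδ)
  have hray : P x + (1 + s * δ⁻¹) • (x - P x) = P y + (1 + t * δ⁻¹) • (y - P y) := by
    rw [hu x (hx ▸ hδ), hu y (hy ▸ hδ), hx, hy] at heq
    simpa only [add_smul, one_smul, mul_smul, ← add_assoc, add_sub_cancel] using heq
  have hpq : P x = P y := eq_of_add_smul_eq_add_smul_of_inner_nonpos hc.le hd.le
    (inner_sub_sub_nonpos_of_dist_eq_infDist hconv hpx hpy hdx)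
    (inner_sub_sub_nonpos_of_dist_eq_infDist hconv hpy hpx hdy) hray
  rw [dist_eq_norm, hx] at hdx
  rw [dist_eq_norm, hy] at hdy
  rw [hpq] at hray hdx
  have hsmul := add_left_cancel hray
  have hcd : 1 + s * δ⁻¹ = 1 + t * δ⁻¹ := by
    have hnorm := congrArg norm hsmul
    rw [norm_smul_of_nonneg hc.le, norm_smul_of_nonneg hd.le, hdx, hdy] at hnorm
    exact mul_right_cancel₀ hδ.ne' hnorm
  refine ⟨?_, mul_right_cancel₀ (inv_ne_zero hδ.ne') (add_left_cancel hcd)⟩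
  rw [hcd] at hsmul
  exact sub_left_injective (smul_right_injective _ hd.ne' hsmul)
end
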